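/- For all integers p, q, r ≥ 1 with q odd, the irreducible symmetric space SO₀(p+r,q)/(SO₀(p,q) × SO(r)) does not admit a compact Clifford–Klein form; that is, there is no discrete subgroup Γ of SO₀(p+r,q) whose left-translation action on SO₀(p+r,q)/(SO₀(p,q) × SO(r)) is properly discontinuous and free and has compact quotient. -/

import Mathlib

/-! Statement 1: For all integers `p, q, r ≥ 1` with `q` odd, the irreducible symmetric
space `SO₀(p+r,q)/(SO₀(p,q) × SO(r))` does not admit a compact Clifford–Klein form. -/

open Matrix

noncomputable section

/-- A homogeneous space `G/H` admits a compact Clifford–Klein form if there is a discrete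
subgroup `Γ` of `G` acting properly discontinuously and freely on `G/H` by left translations
with compact quotient `Γ\G/H`. -/
def AdmitsCompactCliffordKleinForm {G : Type*} [Group G] [TopologicalSpace G]
    (H : Subgroup G) : Prop :=
  ∃ Γ : Subgroup G, DiscreteTopology Γ ∧
    ProperlyDiscontinuousSMul Γ (G ⧸ H) ∧
    (∀ γ : Γ, γ ≠ 1 → ∀ x : G ⧸ H, γ • x ≠ x) ∧
    CompactSpace (Quotient (MulAction.orbitRel Γ (G ⧸ H)))

/-- The matrix `I_{p,q} = diag(1,…,1,−1,…,−1)` (`p` ones, `q` minus ones). -/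
def formMat (p q : ℕ) : Matrix (Fin (p + q)) (Fin (p + q)) ℝ :=
  Matrix.diagonal fun i => if (i : ℕ) < p then (1 : ℝ) else -1

/-- The indefinite orthogonal group `O(p,q)`, as a subgroup of `GL(p+q, ℝ)`:
the group of matrices `A` with `Aᵀ I_{p,q} A = I_{p,q}`. -/
def indefO (p q : ℕ) : Subgroup (GL (Fin (p + q)) ℝ) where
  carrier := {A | (A : Matrix (Fin (p + q)) (Fin (p + q)) ℝ)ᵀ * formMat p q * A = formMat p q}
  one_mem' := by simp
  mul_mem' := by
    intro a b ha hb
    have h : ((a * b : GL (Fin (p + q)) ℝ) : Matrix (Fin (p + q)) (Fin (p + q)) ℝ)ᵀ *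
        formMat p q * ((a * b : GL (Fin (p + q)) ℝ) : Matrix (Fin (p + q)) (Fin (p + q)) ℝ) =
        (b : Matrix (Fin (p + q)) (Fin (p + q)) ℝ)ᵀ *
          ((a : Matrix (Fin (p + q)) (Fin (p + q)) ℝ)ᵀ * formMat p q *
            (a : Matrix (Fin (p + q)) (Fin (p + q)) ℝ)) *
          (b : Matrix (Fin (p + q)) (Fin (p + q)) ℝ) := by
      rw [Units.val_mul, Matrix.transpose_mul]
      simp only [mul_assoc]
    show _ = _
    rw [h, ha, hb]
  inv_mem' := by
    intro a ha
    have h1 : (a : Matrix (Fin (p + q)) (Fin (p + q)) ℝ) *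
        ((a⁻¹ : GL (Fin (p + q)) ℝ) : Matrix (Fin (p + q)) (Fin (p + q)) ℝ) = 1 := by
      rw [← Units.val_mul, mul_inv_cancel, Units.val_one]
    have key : ((a⁻¹ : GL (Fin (p + q)) ℝ) : Matrix (Fin (p + q)) (Fin (p + q)) ℝ)ᵀ *
        ((a : Matrix (Fin (p + q)) (Fin (p + q)) ℝ)ᵀ * formMat p q *
          (a : Matrix (Fin (p + q)) (Fin (p + q)) ℝ)) *
        ((a⁻¹ : GL (Fin (p + q)) ℝ) : Matrix (Fin (p + q)) (Fin (p + q)) ℝ) = formMat p q := by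
      have h2 : ((a⁻¹ : GL (Fin (p + q)) ℝ) : Matrix (Fin (p + q)) (Fin (p + q)) ℝ)ᵀ *
          ((a : Matrix (Fin (p + q)) (Fin (p + q)) ℝ)ᵀ * formMat p q *
            (a : Matrix (Fin (p + q)) (Fin (p + q)) ℝ)) *
          ((a⁻¹ : GL (Fin (p + q)) ℝ) : Matrix (Fin (p + q)) (Fin (p + q)) ℝ) =
          ((a : Matrix (Fin (p + q)) (Fin (p + q)) ℝ) *
            ((a⁻¹ : GL (Fin (p + q)) ℝ) : Matrix (Fin (p + q)) (Fin (p + q)) ℝ))ᵀ *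
            formMat p q *
            ((a : Matrix (Fin (p + q)) (Fin (p + q)) ℝ) *
              ((a⁻¹ : GL (Fin (p + q)) ℝ) : Matrix (Fin (p + q)) (Fin (p + q)) ℝ)) := by
        rw [Matrix.transpose_mul]
        simp only [mul_assoc]
      rw [h2, h1]
      simp
    replace ha : (a : Matrix (Fin (p + q)) (Fin (p + q)) ℝ)ᵀ * formMat p q *
        (a : Matrix (Fin (p + q)) (Fin (p + q)) ℝ) = formMat p q := ha
    rw [ha] at key
    exact key
  
/-- `SO₀(p,q)`: the identity component of `O(p,q)`, as a subgroup of `GL(p+q,ℝ)`. -/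
def SOZero (p q : ℕ) : Subgroup (GL (Fin (p + q)) ℝ) :=
  Subgroup.map (indefO p q).subtype
    (Subgroup.connectedComponentOfOne (indefO p q))

/-- The identification of `Fin (p+r+q)` with `(Fin p ⊕ Fin q) ⊕ Fin r` that sends coordinates
`1,…,p` to the first summand, `p+r+1,…,p+r+q` to the second, and `p+1,…,p+r` to the third. -/
def reindex3 (p r q : ℕ) : Fin (p + r + q) ≃ (Fin p ⊕ Fin q) ⊕ Fin r :=
  (finSumFinEquiv (m := p + r) (n := q)).symm.trans <|
    (((finSumFinEquiv (m := p) (n := r)).symm.sumCongr (Equiv.refl (Fin q))).trans <|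
      ((Equiv.sumAssoc (Fin p) (Fin r) (Fin q)).trans
        ((Equiv.refl (Fin p)).sumCongr (Equiv.sumComm (Fin r) (Fin q)))).trans
        (Equiv.sumAssoc (Fin p) (Fin q) (Fin r)).symm)

/-- The block-diagonal embedding of a pair consisting of a `(p+q)×(p+q)` matrix `B` and an
`r×r` matrix `R` into `(p+r+q)×(p+r+q)` matrices, with `B` acting on the coordinates
`1,…,p` and `p+r+1,…,p+r+q` and `R` acting on the coordinates `p+1,…,p+r`.  It is a
homomorphism of multiplicative monoids. -/
def embedPairHom (p r q : ℕ) :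
    (Matrix (Fin (p + q)) (Fin (p + q)) ℝ) × (Matrix (Fin r) (Fin r) ℝ) →*
      Matrix (Fin (p + r + q)) (Fin (p + r + q)) ℝ where
  toFun BR := (Matrix.fromBlocks (BR.1.submatrix finSumFinEquiv finSumFinEquiv) 0 0
      BR.2).submatrix (reindex3 p r q) (reindex3 p r q)
  map_one' := by
    dsimp only [Prod.fst_one, Prod.snd_one]
    rw [Matrix.submatrix_one_equiv, Matrix.fromBlocks_one, Matrix.submatrix_one_equiv]
  map_mul' := by
    intro B C
    dsimp only [Prod.fst_mul, Prod.snd_mul]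
    simp only [Matrix.submatrix_mul_equiv, Matrix.fromBlocks_multiply, Matrix.mul_zero,
      Matrix.zero_mul, Matrix.mul_one, Matrix.one_mul, add_zero, zero_add]

/-- The subgroup `SO₀(p,q) × SO(r)` of `GL(p+r+q, ℝ)`, where the factor `SO₀(p,q)` acts on
the coordinates `1,…,p` and `p+r+1,…,p+r+q` and the factor `SO(r) = SO₀(r,0)` acts on the
coordinates `p+1,…,p+r`. -/
def SOZeroProdSO (p r q : ℕ) : Subgroup (GL (Fin (p + r + q)) ℝ) :=
  Subgroup.map
    ((Units.map (embedPairHom p r q)).comp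
      (MulEquiv.prodUnits
        (M := Matrix (Fin (p + q)) (Fin (p + q)) ℝ)
        (N := Matrix (Fin r) (Fin r) ℝ)).symm.toMonoidHom)
    ((SOZero p q).prod (SOZero r 0))

section Degree
open MeasureTheory Metric Set

theorem ck_interp (E : Type*) [NormedAddCommGroup E] [NormedSpace ℝ E] [FiniteDimensional ℝ E]
    (t0 : ℝ) (ht0 : 0 < t0) :
    ∃ (s : Finset ℕ) (τ l : ℕ → ℝ), (∀ i ∈ s, 0 ≤ τ i ∧ τ i ≤ t0) ∧ ∑ i ∈ s, l i = 1 ∧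
      ∀ B : E →L[ℝ] E, (1 + B).det = ∑ i ∈ s, l i * (1 + τ i • B).det := by
  classical
  set n := Module.finrank ℝ E
  set s : Finset ℕ := Finset.range (n + 1)
  set τ : ℕ → ℝ := fun i => t0 * (i / (n + 1))
  have hinj : Set.InjOn τ s := by
    intro i _ j _ hij
    simp only [τ] at hij
    have h1 := mul_left_cancel₀ ht0.ne' hij
    have : ((n : ℝ) + 1) ≠ 0 := by positivity
    field_simp at h1
    exact_mod_cast h1
  refine ⟨s, τ, fun i => (Lagrange.basis s τ i).eval 1, ?_, ?_, ?_⟩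
  · intro i hi
    have hi' : (i : ℝ) ≤ n + 1 := by
      have := Finset.mem_range.1 hi
      exact_mod_cast this.le
    refine ⟨by positivity, ?_⟩
    have : (i : ℝ) / (n + 1) ≤ 1 := by
      rw [div_le_one (by positivity)]; exact hi'
    nlinarith
  · rw [← Polynomial.eval_finsetSum, Lagrange.sum_basis hinj ⟨0, by simp [s]⟩]
    simp
  · intro B
    let b := Module.finBasis ℝ E
    let M : Matrix (Fin n) (Fin n) ℝ := LinearMap.toMatrix b b (B : E →ₗ[ℝ] E)
    let P : Polynomial ℝ := ((Polynomial.X : Polynomial ℝ) • M.map (Polynomial.C : ℝ →+* Polynomial ℝ) +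
      (1 : Matrix (Fin n) (Fin n) ℝ).map (Polynomial.C : ℝ →+* Polynomial ℝ)).det
    have hP : ∀ t : ℝ, P.eval t = (1 + t • B).det := by
      intro t
      have h1 : (1 + t • B).det = (1 + t • M).det := by
        change LinearMap.det ((1 + t • B : E →L[ℝ] E) : E →ₗ[ℝ] E) = _
        rw [← LinearMap.det_toMatrix b]
        congr 1
        simp only [M, ContinuousLinearMap.toLinearMap_add, ContinuousLinearMap.toLinearMap_smul,
          map_add, map_smul]
        congr 1
        exact LinearMap.toMatrix_one b
      rw [h1]
      simp only [P]
      rw [← Polynomial.coe_evalRingHom, RingHom.map_det]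
      congr 1
      ext i j
      by_cases hij : i = j
      · subst hij; simp [add_comm]; ring
      · simp [hij]; ring
    have hdeg : P.degree < s.card := by
      refine lt_of_le_of_lt Polynomial.degree_le_natDegree ?_
      have := Polynomial.natDegree_det_X_add_C_le M (1 : Matrix (Fin n) (Fin n) ℝ)
      simp only [Fintype.card_fin] at this
      simp only [s, Finset.card_range]
      exact_mod_cast Nat.lt_succ_of_le this
    have h2 := Lagrange.eq_interpolate (s := s) (v := τ) (f := P) hinj hdeg
    have h3 := congrArg (Polynomial.eval 1) h2
    rw [hP, Lagrange.interpolate_apply, Polynomial.eval_finsetSum] at h3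
    simp only [one_smul, Polynomial.eval_mul, Polynomial.eval_C, hP] at h3
    rw [h3]
    exact Finset.sum_congr rfl fun i _ => mul_comm _ _

theorem ck_det_pos {E : Type*} [NormedAddCommGroup E] [NormedSpace ℝ E] [FiniteDimensional ℝ E]
    (B : E →L[ℝ] E) (hB : ‖B‖ < 1) : 0 < (1 + B).det := by
  have hc : Continuous fun t : ℝ => (1 + t • B).det :=
    ContinuousLinearMap.continuous_det.comp (by fun_prop)
  have hne : ∀ t ∈ Icc (0:ℝ) 1, (1 + t • B).det ≠ 0 := by
    intro t ht
    have : IsUnit (1 + t • B) := by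
      have h : ‖-(t • B)‖ < 1 := by
        rw [norm_neg, norm_smul, Real.norm_of_nonneg ht.1]
        nlinarith [ht.2, norm_nonneg B]
      have := isUnit_one_sub_of_norm_lt_one h
      simpa using this
    have h2 : IsUnit (LinearMap.det ((1 + t • B : E →L[ℝ] E) : E →ₗ[ℝ] E)) := by
      have h3 : IsUnit ((1 + t • B : E →L[ℝ] E) : E →ₗ[ℝ] E) :=
        this.map (ContinuousLinearMap.toLinearMapRingHom : (E →L[ℝ] E) →+* (E →ₗ[ℝ] E))
      exact h3.map LinearMap.det
    exact h2.ne_zero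
  by_contra hneg
  push Not at hneg
  have h0 : (1 + (0:ℝ) • B).det = 1 := by
    simp only [zero_smul, add_zero]
    change LinearMap.det (LinearMap.id : E →ₗ[ℝ] E) = 1
    simp
  have := intermediate_value_Icc' (f := fun t : ℝ => (1 + t • B).det) zero_le_one hc.continuousOn
  obtain ⟨t, ht, h⟩ := this (show (0:ℝ) ∈ Icc _ _ from ⟨by simpa using hneg, by rw [h0]; norm_num⟩)
  exact hne t ht h

variable {E : Type*} [NormedAddCommGroup E] [NormedSpace ℝ E] [FiniteDimensional ℝ E]
  [MeasurableSpace E] [BorelSpace E] (μ : Measure E) [μ.IsAddHaarMeasure]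

theorem ck_int_det (h : E → E) (hh : ContDiff ℝ 1 h) (ρ : ℝ) (hρ : 0 < ρ)
    (hb : ∀ x, ‖x‖ = ρ → h x = x) :
    ∫ x in ball 0 ρ, (fderiv ℝ h x).det ∂μ = μ.real (ball 0 ρ) := by
  classical
  set g : E → E := fun x => h x - x with hg
  have hgd : ContDiff ℝ 1 g := hh.sub contDiff_id
  have hgdiff : Differentiable ℝ g := hgd.differentiable (by norm_num)
  have hg0 : ∀ x, ‖x‖ = ρ → g x = 0 := fun x hx => by simp [hg, hb x hx]
  have hcf : Continuous (fderiv ℝ g) := hgd.continuous_fderiv (by norm_num)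
  obtain ⟨C, hC⟩ := (isCompact_closedBall (0:E) ρ).exists_bound_of_continuousOn hcf.continuousOn
  have hC0 : 0 ≤ C := (norm_nonneg _).trans (hC 0 (by simp [hρ.le]))
  have hlip : ∀ x ∈ closedBall (0:E) ρ, ∀ y ∈ closedBall (0:E) ρ, ‖g y - g x‖ ≤ C * ‖y - x‖ :=
    fun x hx y hy => Convex.norm_image_sub_le_of_norm_fderiv_le (𝕜 := ℝ)
      (fun z _ => hgdiff z) hC (convex_closedBall 0 ρ) hx hy
  -- the extension by zero
  set G : E → E := fun x => if ‖x‖ ≤ ρ then g x else 0 with hG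
  have hcross : ∀ x y, ‖x‖ ≤ ρ → ρ < ‖y‖ → ‖g x‖ ≤ C * ‖y - x‖ := by
    intro x y hx hy
    have hc : Continuous fun t : ℝ => ‖x + t • (y - x)‖ := by fun_prop
    have := intermediate_value_Icc (f := fun t : ℝ => ‖x + t • (y - x)‖) zero_le_one hc.continuousOn
    obtain ⟨t, ht, hz⟩ := this (show ρ ∈ Icc _ _ from ⟨by simpa using hx, by simpa using hy.le⟩)
    simp only at hz
    have h1 := hlip (x + t • (y - x)) (by simp [hz]) x (by simpa using hx)
    rw [hg0 _ hz, sub_zero] at h1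
    refine h1.trans (mul_le_mul_of_nonneg_left ?_ hC0)
    rw [show x - (x + t • (y - x)) = -(t • (y - x)) by abel, norm_neg, norm_smul,
      Real.norm_of_nonneg ht.1]
    nlinarith [ht.2, norm_nonneg (y - x)]
  have hGlip : ∀ x y, ‖G y - G x‖ ≤ C * ‖y - x‖ := by
    intro x y
    simp only [hG]
    split_ifs with h1 h2 h2
    · exact hlip x (by simpa using h2) y (by simpa using h1)
    · rw [sub_zero, norm_sub_rev y x]; exact hcross y x h1 (not_le.1 h2)
    · rw [zero_sub, norm_neg]; exact hcross x y h2 (not_le.1 h1)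
    · simp; positivity
  set t0 : ℝ := 1 / (2 * (C + 1)) with ht0
  have ht0p : 0 < t0 := by positivity
  have ht0C : t0 * C < 1 := by
    rw [ht0, div_mul_eq_mul_div, div_lt_one (by positivity)]; linarith
  have key : ∀ t, 0 ≤ t → t ≤ t0 →
      ∫ x in ball 0 ρ, (1 + t • fderiv ℝ g x).det ∂μ = μ.real (ball 0 ρ) := by
    intro t ht htt
    have htC : t * C < 1 := lt_of_le_of_lt (mul_le_mul_of_nonneg_right htt hC0) ht0C
    set f : E → E := fun x => x + t • G x with hf
    have hfinj : Function.Injective f := by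
      intro x y hxy
      have h1 : y - x = - (t • (G y - G x)) := by
        simp only [hf] at hxy
        rw [smul_sub]
        have : t • G x = y + t • G y - x := by rw [← hxy]; abel
        rw [this]; abel
      have h2 : ‖y - x‖ ≤ t * (C * ‖y - x‖) := by
        conv_lhs => rw [h1]
        rw [norm_neg, norm_smul, Real.norm_of_nonneg ht]
        exact mul_le_mul_of_nonneg_left (hGlip x y) ht
      have h3 : ‖y - x‖ = 0 := by nlinarith [norm_nonneg (y - x)]
      exact (sub_eq_zero.1 (norm_eq_zero.1 h3)).symm
    have hfsurj : Function.Surjective f := by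
      intro y
      have hcon : ContractingWith (t * C).toNNReal (fun x => y - t • G x) := by
        refine ⟨by rw [Real.toNNReal_lt_one]; exact htC, LipschitzWith.of_dist_le_mul fun a b => ?_⟩
        rw [dist_eq_norm, dist_eq_norm]
        rw [show y - t • G a - (y - t • G b) = t • (G b - G a) by rw [smul_sub]; abel,
          norm_smul, Real.norm_of_nonneg ht, norm_sub_rev a b]
        rw [Real.coe_toNNReal _ (by positivity), mul_assoc]
        exact mul_le_mul_of_nonneg_left (hGlip a b) ht
      have hfix := hcon.fixedPoint_isFixedPt
      refine ⟨ContractingWith.fixedPoint _ hcon, ?_⟩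
      · simp only [hf]
        have h1 : y - t • G (ContractingWith.fixedPoint _ hcon) = ContractingWith.fixedPoint _ hcon := hfix
        rw [eq_comm, ← sub_eq_iff_eq_add]
        exact h1
    have hfout : ∀ x, x ∉ ball (0:E) ρ → f x = x := by
      intro x hx
      have hx' : ρ ≤ ‖x‖ := by simpa using hx
      simp only [hf, hG]
      split_ifs with h1
      · rw [hg0 x (le_antisymm h1 hx')]; simp
      · simp
    have himg : f '' ball 0 ρ = ball 0 ρ := by
      apply Subset.antisymm
      · rintro _ ⟨x, hx, rfl⟩
        by_contra hcon
        have := hfout _ hcon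
        rw [hfinj this] at hcon
        exact hcon hx
      · intro y hy
        obtain ⟨x, rfl⟩ := hfsurj y
        by_cases hx : x ∈ ball (0:E) ρ
        · exact ⟨x, hx, rfl⟩
        · rw [hfout x hx] at hy; exact absurd hy hx
    have hder : ∀ x ∈ ball (0:E) ρ, HasFDerivWithinAt f (1 + t • fderiv ℝ g x) (ball 0 ρ) x := by
      intro x hx
      have h1 : HasFDerivAt (fun x => x + t • g x) (1 + t • fderiv ℝ g x) x :=
        (hasFDerivAt_id x).add ((hgdiff x).hasFDerivAt.const_smul t)
      refine h1.hasFDerivWithinAt.congr ?_ ?_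
      · intro y hy
        have : ‖y‖ ≤ ρ := by simpa using (mem_ball.1 hy).le
        simp [hf, hG, this]
      · have : ‖x‖ ≤ ρ := by simpa using (mem_ball.1 hx).le
        simp [hf, hG, this]
    have h4 := integral_image_eq_integral_abs_det_fderiv_smul μ measurableSet_ball hder
      hfinj.injOn (fun _ => (1:ℝ))
    rw [himg] at h4
    simp only [smul_eq_mul, mul_one, integral_const, measureReal_restrict_apply_univ] at h4
    rw [h4]
    refine setIntegral_congr_fun measurableSet_ball fun x hx => ?_
    rw [abs_of_pos]
    apply ck_det_pos
    rw [norm_smul, Real.norm_of_nonneg ht]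
    exact lt_of_le_of_lt (mul_le_mul_of_nonneg_left (hC x (ball_subset_closedBall hx)) ht) htC
  obtain ⟨s, τ, l, hτ, hl, hi⟩ := ck_interp E t0 ht0p
  have hfd : ∀ x, fderiv ℝ h x = 1 + fderiv ℝ g x := by
    intro x
    have h1 : fderiv ℝ g x = fderiv ℝ h x - 1 := by
      simp only [hg]
      rw [fderiv_fun_sub (hh.differentiable (by norm_num) x) differentiableAt_fun_id, fderiv_fun_id]
      rfl
    rw [h1]; abel
  have hfd' : ∀ x, (fderiv ℝ h x).det = ∑ i ∈ s, l i * (1 + τ i • fderiv ℝ g x).det :=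
    fun x => by rw [hfd, hi]
  simp_rw [hfd']
  have hIntg : ∀ t : ℝ, IntegrableOn (fun x => (1 + t • fderiv ℝ g x).det) (ball 0 ρ) μ := by
    intro t
    have hc : Continuous fun x => (1 + t • fderiv ℝ g x).det :=
      ContinuousLinearMap.continuous_det.comp (by fun_prop)
    exact (hc.continuousOn.integrableOn_compact (isCompact_closedBall 0 ρ)).mono_set
      ball_subset_closedBall
  rw [integral_finsetSum _ fun i _ => (hIntg (τ i)).const_mul (l i)]
  simp_rw [integral_const_mul]
  rw [Finset.sum_congr rfl fun i hi' => by rw [key (τ i) (hτ i hi').1 (hτ i hi').2],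
    ← Finset.sum_mul, hl, one_mul]
end Degree

section Degree2
open MeasureTheory Metric Set

theorem ck_det_zero {E : Type*} [NormedAddCommGroup E] [NormedSpace ℝ E] [FiniteDimensional ℝ E]
    (A : E →L[ℝ] E) (y : E) (hy : y ≠ 0) (hA : A y = 0) : A.det = 0 := by
  by_contra h
  have h1 : IsUnit (LinearMap.det (A : E →ₗ[ℝ] E)) := isUnit_iff_ne_zero.2 h
  have h2 := (LinearMap.equivOfIsUnitDet h1).injective
  apply hy
  apply h2
  simp [hA]

theorem ck_degree {E : Type*} [NormedAddCommGroup E] [InnerProductSpace ℝ E]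
    [FiniteDimensional ℝ E] (F : E → E) (hF : ContDiff ℝ 1 F) (L : E →L[ℝ] E) (hL : L.det < 0)
    (h1 : ∀ x, ‖x‖ < 1 → F x = L x) (h6 : ∀ x, 6 < ‖x‖ → F x = x)
    (h0 : ∀ x, x ≠ 0 → F x ≠ 0) : False := by
  classical
  borelize E
  let μ : Measure E := Measure.addHaar
  obtain ⟨ε, hε, hε1, hεF⟩ : ∃ ε : ℝ, 0 < ε ∧ ε ≤ 1 ∧ ∀ x, 1/2 ≤ ‖x‖ → ‖x‖ ≤ 7 → ε ≤ ‖F x‖ := by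
    have hK : IsCompact (closedBall (0:E) 7 ∩ {x | 1/2 ≤ ‖x‖}) :=
      (isCompact_closedBall 0 7).inter_right (isClosed_le continuous_const continuous_norm)
    rcases (closedBall (0:E) 7 ∩ {x | 1/2 ≤ ‖x‖}).eq_empty_or_nonempty with he | hne
    · refine ⟨1, one_pos, le_rfl, fun x hx hx' => ?_⟩
      exfalso
      have : x ∈ closedBall (0:E) 7 ∩ {x | 1/2 ≤ ‖x‖} := ⟨by simpa using hx', hx⟩
      rw [he] at this
      exact this
    · obtain ⟨x0, hx0, hmin⟩ := hK.exists_isMinOn hne (hF.continuous.norm.continuousOn)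
      have hx0' : x0 ≠ 0 := by
        rintro rfl
        have := hx0.2
        simp at this
        norm_num at this
      refine ⟨min 1 ‖F x0‖, lt_min one_pos (norm_pos_iff.2 (h0 x0 hx0')), min_le_left _ _, ?_⟩
      intro x hx hx'
      exact (min_le_right _ _).trans (hmin (show x ∈ _ from ⟨by simpa using hx', hx⟩))
  let bump : ContDiffBump (0:E) := ⟨ε/4, ε/2, by positivity, by linarith⟩
  set ψ : E → E := fun y => ((1 - bump y) * (7 * ‖y‖⁻¹)) • y with hψ
  have hψs : ContDiff ℝ 1 ψ := by
    rw [contDiff_iff_contDiffAt]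
    intro y
    by_cases hy : y = 0
    · subst hy
      have : ψ =ᶠ[nhds 0] fun _ => (0:E) := by
        filter_upwards [ball_mem_nhds (0:E) (show 0 < ε/4 by positivity)] with z hz
        have : bump z = 1 := bump.one_of_mem_closedBall (ball_subset_closedBall hz)
        simp [hψ, this]
      exact contDiffAt_const.congr_of_eventuallyEq this
    · refine ContDiffAt.smul ?_ contDiffAt_id
      refine ContDiffAt.mul (contDiffAt_const.sub bump.contDiffAt) ?_
      exact contDiffAt_const.mul ((contDiffAt_norm ℝ hy).inv (by simpa using hy))
  have hψe : ∀ y, ε/2 ≤ ‖y‖ → ψ y = (7 * ‖y‖⁻¹) • y := by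
    intro y hy
    have : bump y = 0 := bump.zero_of_le_dist (by simpa using hy)
    simp [hψ, this]
  set k : E → ℝ := fun y => (fderiv ℝ ψ y).det with hk
  have hk0 : ∀ y, ε ≤ ‖y‖ → k y = 0 := by
    intro y hy
    have hy0 : y ≠ 0 := by
      rintro rfl
      simp at hy; linarith
    have hny : 0 < ‖y‖ := norm_pos_iff.2 hy0
    refine ck_det_zero _ y hy0 ?_
    have hd : HasFDerivAt ψ (fderiv ℝ ψ y) y := (hψs.differentiable (by norm_num) y).hasFDerivAt
    have hc : HasDerivAt (fun t : ℝ => t • y) y 1 := by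
      simpa using (hasDerivAt_id (1:ℝ)).smul_const y
    have hcomp : HasDerivAt (fun t : ℝ => ψ (t • y)) ((fderiv ℝ ψ y) y) 1 := by
      have hd' : HasFDerivAt ψ (fderiv ℝ ψ y) ((1:ℝ) • y) := by rw [one_smul]; exact hd
      exact hd'.comp_hasDerivAt (1:ℝ) hc
    have hconst : (fun t : ℝ => ψ (t • y)) =ᶠ[nhds 1] fun _ => (7 * ‖y‖⁻¹) • y := by
      filter_upwards [lt_mem_nhds (show (1/2:ℝ) < 1 by norm_num)] with t ht
      have ht0 : (0:ℝ) < t := by linarith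
      have hn : ‖t • y‖ = t * ‖y‖ := by rw [norm_smul, Real.norm_of_nonneg ht0.le]
      rw [hψe _ (by rw [hn]; nlinarith), hn, smul_smul]
      congr 1
      field_simp
    have h2 := (hasDerivAt_const (1:ℝ) ((7 * ‖y‖⁻¹) • y)).congr_of_eventuallyEq hconst
    exact hcomp.unique h2
  have hdetne : L.det ≠ 0 := hL.ne
  have hV : 0 < μ.real (ball (0:E) 7) := by
    rw [measureReal_def]
    exact ENNReal.toReal_pos (measure_ball_pos μ 0 (by norm_num)).ne' measure_ball_lt_top.ne
  have e1 : ∫ y, k y ∂μ = μ.real (ball (0:E) 7) := by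
    rw [← ck_int_det μ ψ hψs 7 (by norm_num) (fun x hx => by
      rw [hψe x (by rw [hx]; linarith), hx]; norm_num)]
    rw [setIntegral_eq_integral_of_forall_compl_eq_zero]
    intro x hx
    exact hk0 x (by have : 7 ≤ ‖x‖ := by simpa using hx
                    linarith)
  have hLk : ∀ x, 1 ≤ ‖x‖ → k (L x) = 0 := by
    intro x hx
    apply hk0
    have hn : 0 < ‖x‖ := by linarith
    have h3 := hεF ((1 / (2 * ‖x‖)) • x) (by
      rw [norm_smul, Real.norm_of_nonneg (by positivity)]; field_simp; norm_num) (by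
      rw [norm_smul, Real.norm_of_nonneg (by positivity)]; field_simp; norm_num)
    rw [h1 _ (by rw [norm_smul, Real.norm_of_nonneg (by positivity)]; field_simp; norm_num),
      map_smul, norm_smul, Real.norm_of_nonneg (by positivity)] at h3
    have h4 : 1 / (2 * ‖x‖) ≤ 1 := by
      rw [div_le_one (by positivity)]; linarith
    nlinarith [norm_nonneg (L x)]
  have e2 : ∫ x, L.det * k (L x) ∂μ = μ.real (ball (0:E) 7) := by
    have hFd : Differentiable ℝ F := hF.differentiable (by norm_num)
    rw [← ck_int_det μ (ψ ∘ F) (hψs.comp hF) 7 (by norm_num) (fun x hx => by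
      rw [Function.comp_apply, h6 x (by rw [hx]; norm_num), hψe x (by rw [hx]; linarith), hx]
      norm_num)]
    rw [← setIntegral_eq_integral_of_forall_compl_eq_zero (s := ball (0:E) 7)]
    · refine setIntegral_congr_fun measurableSet_ball fun x hx => ?_
      have hx' : ‖x‖ < 7 := by simpa using hx
      have hch : (fderiv ℝ (ψ ∘ F) x).det = k (F x) * (fderiv ℝ F x).det := by
        rw [fderiv_comp x (hψs.differentiable (by norm_num) _) (hFd x)]
        exact LinearMap.det_comp _ _
      show L.det * k (L x) = (fderiv ℝ (ψ ∘ F) x).det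
      rw [hch]
      by_cases hx1 : ‖x‖ < 1
      · have : F =ᶠ[nhds x] L := by
          have : ball (0:E) 1 ∈ nhds x := isOpen_ball.mem_nhds (by simpa using hx1)
          filter_upwards [this] with z hz
          exact h1 z (by simpa using hz)
        rw [this.fderiv_eq, L.fderiv, h1 x hx1, mul_comm]
      · push Not at hx1
        rw [hLk x hx1, hk0 (F x) (hεF x (by linarith) hx'.le)]
        simp
    · intro x hx
      rw [hLk x (by have : 7 ≤ ‖x‖ := by simpa using hx
                    linarith), mul_zero]
  have e3 : ∫ x, k (L x) ∂μ = |L.det|⁻¹ * ∫ y, k y ∂μ := by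
    have hmap := Measure.map_linearMap_addHaar_eq_smul_addHaar μ (f := (L : E →ₗ[ℝ] E)) hdetne
    have hkc : Continuous k :=
      ContinuousLinearMap.continuous_det.comp (hψs.continuous_fderiv (by norm_num))
    have h5 : ∫ x, k (L x) ∂μ = ∫ y, k y ∂(Measure.map (L : E →ₗ[ℝ] E) μ) :=
      (integral_map (φ := (L : E → E)) L.continuous.aemeasurable
        hkc.aestronglyMeasurable).symm
    rw [h5, hmap, integral_smul_measure, ENNReal.toReal_ofReal (abs_nonneg _), abs_inv,
      smul_eq_mul]
  rw [integral_const_mul, e3, e1, abs_of_neg hL] at e2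
  have : L.det * ((-L.det)⁻¹ * μ.real (ball (0:E) 7)) = - μ.real (ball (0:E) 7) := by
    field_simp
  linarith
end Degree2

section LinAlg
set_option linter.unusedSectionVars false
variable {I K : Type*} [Fintype I] [Fintype K]

/-- squared Frobenius norm -/
def ckFro (A : Matrix I K ℝ) : ℝ := ∑ i, ∑ j, A i j ^ 2
/-- squared Euclidean norm -/
def ckN (z : I → ℝ) : ℝ := ∑ i, z i ^ 2
/-- diagonal quadratic form -/
def ckQ (sg : I → ℝ) (z : I → ℝ) : ℝ := ∑ i, sg i * z i ^ 2

theorem ckFro_nonneg (A : Matrix I K ℝ) : 0 ≤ ckFro A :=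
  Finset.sum_nonneg fun _ _ => Finset.sum_nonneg fun _ _ => sq_nonneg _

theorem ckN_nonneg (z : I → ℝ) : 0 ≤ ckN z := Finset.sum_nonneg fun _ _ => sq_nonneg _

theorem ckN_eq_zero {z : I → ℝ} : ckN z = 0 ↔ z = 0 := by
  rw [ckN, Finset.sum_eq_zero_iff_of_nonneg fun _ _ => sq_nonneg _]
  simp [funext_iff]

theorem ckN_pos {z : I → ℝ} (hz : z ≠ 0) : 0 < ckN z :=
  lt_of_le_of_ne (ckN_nonneg z) fun h => hz (ckN_eq_zero.1 h.symm)

theorem ckN_smul (c : ℝ) (z : I → ℝ) : ckN (c • z) = c ^ 2 * ckN z := by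
  simp [ckN, Finset.mul_sum, mul_pow]

theorem ckQ_smul (sg : I → ℝ) (c : ℝ) (z : I → ℝ) : ckQ sg (c • z) = c ^ 2 * ckQ sg z := by
  simp only [ckQ, Finset.mul_sum, Pi.smul_apply, smul_eq_mul]
  exact Finset.sum_congr rfl fun i _ => by ring

theorem ckN_eq_dot (z : I → ℝ) : ckN z = z ⬝ᵥ z := by simp [ckN, dotProduct, sq]

theorem ckN_mulVec_le (A : Matrix I K ℝ) (z : K → ℝ) : ckN (A *ᵥ z) ≤ ckFro A * ckN z := by
  rw [ckFro, Finset.sum_mul]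
  exact Finset.sum_le_sum fun i _ => Finset.sum_mul_sq_le_sq_mul_sq Finset.univ (A i) z

theorem ckFro_eq_cols (A : Matrix I K ℝ) : ckFro A = ∑ j, ckN (fun i => A i j) := by
  simp only [ckFro, ckN]; exact Finset.sum_comm

theorem ckFro_transpose (A : Matrix I K ℝ) : ckFro Aᵀ = ckFro A := by
  simp only [ckFro, transpose_apply]; exact Finset.sum_comm

theorem ckFro_mul_le {L : Type*} [Fintype L] (A : Matrix I K ℝ) (B : Matrix K L ℝ) :
    ckFro (A * B) ≤ ckFro A * ckFro B := by
  rw [ckFro_eq_cols (A * B), ckFro_eq_cols B, Finset.mul_sum]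
  exact Finset.sum_le_sum fun j _ => ckN_mulVec_le A (fun i => B i j)

theorem ckFro_one [DecidableEq I] : ckFro (1 : Matrix I I ℝ) = Fintype.card I := by
  simp [ckFro, Matrix.one_apply, ite_pow]

theorem continuous_ckFro : Continuous (ckFro : Matrix I K ℝ → ℝ) := by
  unfold ckFro
  refine continuous_finsetSum _ fun i _ => continuous_finsetSum _ fun j _ => ?_
  exact ((continuous_apply j).comp (continuous_apply i)).pow 2

theorem continuous_ckN : Continuous (ckN : (I → ℝ) → ℝ) := by unfold ckN; fun_prop
theorem continuous_ckQ (sg : I → ℝ) : Continuous (ckQ sg) := by unfold ckQ; fun_prop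

theorem ck_cmul {L X : Type*} [TopologicalSpace X] {f : X → Matrix I K ℝ} {g : X → Matrix K L ℝ}
    {x : X} (hf : ContinuousAt f x) (hg : ContinuousAt g x) :
    ContinuousAt (fun x => f x * g x) x := by
  have h : Continuous (fun p : Matrix I K ℝ × Matrix K L ℝ => p.1 * p.2) :=
    continuous_fst.matrix_mul continuous_snd
  exact ContinuousAt.comp (f := fun x => (f x, g x)) h.continuousAt (hf.prodMk hg)

theorem ck_ctrans {X : Type*} [TopologicalSpace X] {f : X → Matrix I K ℝ}
    {x : X} (hf : ContinuousAt f x) : ContinuousAt (fun x => (f x)ᵀ) x := by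
  have h : Continuous (fun p : Matrix I K ℝ => pᵀ) := continuous_id.matrix_transpose
  exact ContinuousAt.comp (f := f) h.continuousAt hf

theorem ck_cmulVec {X : Type*} [TopologicalSpace X] {f : X → Matrix I K ℝ} {g : X → K → ℝ}
    {x : X} (hf : ContinuousAt f x) (hg : ContinuousAt g x) :
    ContinuousAt (fun x => f x *ᵥ g x) x := by
  have h : Continuous (fun p : Matrix I K ℝ × (K → ℝ) => p.1 *ᵥ p.2) :=
    continuous_fst.matrix_mulVec continuous_snd
  exact ContinuousAt.comp (f := fun x => (f x, g x)) h.continuousAt (hf.prodMk hg)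

variable [DecidableEq I]

theorem ckQ_eq_dot (sg : I → ℝ) (z : I → ℝ) : ckQ sg z = z ⬝ᵥ (diagonal sg *ᵥ z) := by
  simp only [ckQ, dotProduct, mulVec_diagonal]
  exact Finset.sum_congr rfl fun i _ => by ring

theorem ckQ_mulVec {sg : I → ℝ} {A : Matrix I I ℝ} (hA : Aᵀ * diagonal sg * A = diagonal sg)
    (z : I → ℝ) : ckQ sg (A *ᵥ z) = ckQ sg z := by
  rw [ckQ_eq_dot, ckQ_eq_dot]
  conv_rhs => rw [← hA]
  simp only [← mulVec_mulVec, dotProduct_mulVec, vecMul_transpose]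

variable {sg : I → ℝ}

theorem ck_JJ (hsg : ∀ i, sg i * sg i = 1) : diagonal sg * diagonal sg = (1 : Matrix I I ℝ) := by
  rw [diagonal_mul_diagonal]; simp [hsg]

theorem ck_left_inv (hsg : ∀ i, sg i * sg i = 1) {A : Matrix I I ℝ} (hA : Aᵀ * diagonal sg * A = diagonal sg) :
    (diagonal sg * Aᵀ * diagonal sg) * A = 1 := by
  rw [mul_assoc, mul_assoc, ← mul_assoc Aᵀ, hA, ck_JJ hsg]

theorem ck_transpose_J (hsg : ∀ i, sg i * sg i = 1) {A : Matrix I I ℝ} (hA : Aᵀ * diagonal sg * A = diagonal sg) :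
    A * diagonal sg * Aᵀ = diagonal sg := by
  have h := mul_eq_one_comm.1 (ck_left_inv hsg hA)
  have h2 : (A * diagonal sg * Aᵀ) * (diagonal sg * diagonal sg) = diagonal sg := by
    have := congrArg (· * diagonal sg) h
    simpa [mul_assoc] using this
  rwa [ck_JJ hsg, mul_one] at h2

theorem ckFro_JTJ (hsg : ∀ i, sg i * sg i = 1) (A : Matrix I I ℝ) : ckFro (diagonal sg * Aᵀ * diagonal sg) = ckFro A := by
  rw [← ckFro_transpose A]
  refine Finset.sum_congr rfl fun i _ => Finset.sum_congr rfl fun j _ => ?_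
  rw [mul_diagonal, diagonal_mul]
  calc (sg i * Aᵀ i j * sg j) ^ 2 = (sg i * sg i) * (sg j * sg j) * (Aᵀ i j) ^ 2 := by ring
    _ = _ := by rw [hsg, hsg]; ring
end LinAlg

section Elem
set_option linter.unusedSectionVars false
variable {I : Type*} [Fintype I] [DecidableEq I]

/-- matrix acting in the plane of two coordinates -/
def ckPlane (a b : I) (c s s' : ℝ) : Matrix I I ℝ := fun i j =>
  if i = a then (if j = a then c else if j = b then s else 0)
  else if i = b then (if j = a then s' else if j = b then c else 0)
  else if i = j then 1 else 0

theorem ckPlane_transpose {a b : I} (hab : a ≠ b) (c s s' : ℝ) :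
    (ckPlane a b c s s')ᵀ = ckPlane a b c s' s := by
  ext i j
  simp only [ckPlane, transpose_apply]
  grind

theorem ckPlane_mulVec {a b : I} (hab : a ≠ b) (c s s' : ℝ) (z : I → ℝ) (i : I) :
    (ckPlane a b c s s' *ᵥ z) i = if i = a then c * z a + s * z b else
      if i = b then s' * z a + c * z b else z i := by
  simp only [mulVec, dotProduct, ckPlane]
  split_ifs with h1 h2
  · rw [Finset.sum_eq_add a b hab]
    · simp [hab.symm]
    · intro j _ hj; simp [hj.1, hj.2]
    · simp
    · simp
  · rw [Finset.sum_eq_add a b hab]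
    · simp [hab.symm]
    · intro j _ hj; simp [hj.1, hj.2]
    · simp
    · simp
  · simp

theorem ck_of_quad {sg : I → ℝ} {A : Matrix I I ℝ} (h : ∀ z, ckQ sg (A *ᵥ z) = ckQ sg z) :
    Aᵀ * diagonal sg * A = diagonal sg := by
  have hb : ∀ x y : I → ℝ, (A *ᵥ x) ⬝ᵥ (diagonal sg *ᵥ (A *ᵥ y)) = x ⬝ᵥ (diagonal sg *ᵥ y) := by
    have hsym : ∀ x y : I → ℝ, x ⬝ᵥ (diagonal sg *ᵥ y) = y ⬝ᵥ (diagonal sg *ᵥ x) := by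
      intro x y
      simp only [dotProduct, mulVec_diagonal]
      exact Finset.sum_congr rfl fun i _ => by ring
    intro x y
    have h1 := h (x + y)
    have h2 := h x
    have h3 := h y
    simp only [ckQ_eq_dot, mulVec_add, dotProduct_add, add_dotProduct] at h1 h2 h3
    rw [hsym (A *ᵥ y) (A *ᵥ x), hsym y x] at h1
    linarith
  apply Matrix.ext_of_mulVec_single
  intro j
  ext i
  have := hb (Pi.single i 1) (Pi.single j 1)
  rw [← mulVec_mulVec, ← mulVec_mulVec]
  have e : ∀ z : I → ℝ, z i = Pi.single i 1 ⬝ᵥ z := by simp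
  refine (e _).trans (Eq.trans ?_ (e _).symm)
  rw [dotProduct_mulVec, vecMul_transpose, this]

theorem ckPlane_form {sg : I → ℝ} {a b : I} (hab : a ≠ b) {c s s' : ℝ}
    (h1 : sg a * c ^ 2 + sg b * s' ^ 2 = sg a) (h2 : sg a * s ^ 2 + sg b * c ^ 2 = sg b)
    (h3 : sg a * c * s + sg b * s' * c = 0) :
    (ckPlane a b c s s')ᵀ * diagonal sg * ckPlane a b c s s' = diagonal sg := by
  apply ck_of_quad
  intro z
  simp only [ckQ, ckPlane_mulVec hab]
  rw [← sub_eq_zero, ← Finset.sum_sub_distrib, Finset.sum_eq_add a b hab]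
  · simp only [hab.symm, if_true, if_false]
    linear_combination (z a)^2 * h1 + (z b)^2 * h2 + 2 * z a * z b * h3
  · intro j _ hj; simp [hj.1, hj.2]
  · simp
  · simp

theorem ckPlane_one (a b : I) : ckPlane a b 1 0 0 = 1 := by
  ext i j
  simp only [ckPlane, one_apply]
  split_ifs <;> simp_all

theorem ckPlane_cont {X : Type*} [TopologicalSpace X] (a b : I) {c s s' : X → ℝ}
    (hc : Continuous c) (hs : Continuous s) (hs' : Continuous s') :
    Continuous fun x => ckPlane a b (c x) (s x) (s' x) := by
  refine continuous_matrix fun i j => ?_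
  simp only [ckPlane]
  split_ifs <;> fun_prop

theorem ckPlane_fro_le {a b : I} {c s s' : ℝ} (hc : c ^ 2 ≤ 1) (hs : s ^ 2 ≤ 1)
    (hs' : s' ^ 2 ≤ 1) : ckFro (ckPlane a b c s s') ≤ (Fintype.card I : ℝ) ^ 2 := by
  have : ckFro (ckPlane a b c s s') ≤ ∑ i : I, ∑ j : I, (1:ℝ) := by
    refine Finset.sum_le_sum fun i _ => Finset.sum_le_sum fun j _ => ?_
    simp only [ckPlane]
    split_ifs <;> first | assumption | norm_num
  refine this.trans (le_of_eq ?_)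
  simp [sq]
end Elem

section Setup
set_option linter.unusedSectionVars false
variable {P Q R : Type*} [Fintype P] [Fintype Q] [Fintype R]
  [DecidableEq P] [DecidableEq Q] [DecidableEq R]

/-- signs of the form -/
def ckSg (P Q R : Type*) : (P ⊕ Q) ⊕ R → ℝ := Sum.elim (Sum.elim (fun _ => 1) (fun _ => -1)) (fun _ => 1)

theorem ckSg_sq (i : (P ⊕ Q) ⊕ R) : ckSg P Q R i * ckSg P Q R i = 1 := by
  rcases i with (i | i) | i <;> simp [ckSg]

/-- inclusion of the last block of coordinates -/
def ckIn (P Q : Type*) {R : Type*} (u : R → ℝ) : (P ⊕ Q) ⊕ R → ℝ := Sum.elim (fun _ => 0) u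

/-- inclusion of the negative coordinates -/
def ckInQ (P : Type*) {Q : Type*} (R : Type*) (u : Q → ℝ) : (P ⊕ Q) ⊕ R → ℝ :=
  Sum.elim (Sum.elim (fun _ => 0) u) (fun _ => 0)

/-- the abstract form of the hypotheses -/
structure CKSetup {𝔾 : Type*} [Group 𝔾]
    (m : 𝔾 →* Matrix ((P ⊕ Q) ⊕ R) ((P ⊕ Q) ⊕ R) ℝ) (Γ H : Subgroup 𝔾) : Prop where
  hJ : ∀ g, (m g)ᵀ * diagonal (ckSg P Q R) * m g = diagonal (ckSg P Q R)
  hpath : ∀ c : ℝ → Matrix ((P ⊕ Q) ⊕ R) ((P ⊕ Q) ⊕ R) ℝ, ContinuousOn c (Set.Icc 0 1) → c 0 = 1 →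
    (∀ t ∈ Set.Icc (0:ℝ) 1, (c t)ᵀ * diagonal (ckSg P Q R) * c t = diagonal (ckSg P Q R)) →
      ∃ g, m g = c 1
  hform : ∀ h ∈ H, ∃ (b : Matrix (P ⊕ Q) (P ⊕ Q) ℝ) (R' : Matrix R R ℝ),
    m h = fromBlocks b 0 0 R' ∧ R'ᵀ * R' = 1
  hmin : ∀ g, ∃ h ∈ H, ∀ i j,
    ∑ a, m (g * h) a (Sum.inl (Sum.inl i)) * m (g * h) a (Sum.inl (Sum.inr j)) = 0
  ha : ∃ n, ∀ g, ∃ γ ∈ Γ, ∃ h ∈ H, ckFro (m (γ⁻¹ * g * h)) ≤ n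
  hb : ∀ n, {γ | γ ∈ Γ ∧ ∃ k, ckFro (m k) ≤ n ∧ ∃ h ∈ H, ckFro (m (γ⁻¹ * k * h)) ≤ n}.Finite

theorem ckN_In (u : R → ℝ) : ckN (ckIn P Q u) = ckN u := by
  simp [ckN, ckIn, Fintype.sum_sum_type]

theorem ckQ_In (u : R → ℝ) : ckQ (ckSg P Q R) (ckIn P Q u) = ckN u := by
  simp [ckN, ckQ, ckSg, ckIn, Fintype.sum_sum_type]

theorem ckQ_split (z : (P ⊕ Q) ⊕ R → ℝ) : ckQ (ckSg P Q R) z =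
    (∑ i, z (Sum.inl (Sum.inl i)) ^ 2) - (∑ i, z (Sum.inl (Sum.inr i)) ^ 2) +
      ∑ i, z (Sum.inr i) ^ 2 := by
  simp [ckQ, ckSg, Fintype.sum_sum_type, sub_eq_add_neg]

theorem ckN_split (z : (P ⊕ Q) ⊕ R → ℝ) : ckN z =
    (∑ i, z (Sum.inl (Sum.inl i)) ^ 2) + (∑ i, z (Sum.inl (Sum.inr i)) ^ 2) +
      ∑ i, z (Sum.inr i) ^ 2 := by
  simp [ckN, Fintype.sum_sum_type]

variable {𝔾 : Type*} [Group 𝔾] {m : 𝔾 →* Matrix ((P ⊕ Q) ⊕ R) ((P ⊕ Q) ⊕ R) ℝ} {Γ H : Subgroup 𝔾}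

theorem CKSetup.inv (S : CKSetup m Γ H) (g : 𝔾) :
    m g⁻¹ = diagonal (ckSg P Q R) * (m g)ᵀ * diagonal (ckSg P Q R) := by
  have h1 := ck_left_inv ckSg_sq (S.hJ g)
  have h2 : m g * m g⁻¹ = 1 := by rw [← map_mul]; simp
  exact (left_inv_eq_right_inv h1 h2).symm

theorem CKSetup.fro_inv (S : CKSetup m Γ H) (g : 𝔾) : ckFro (m g⁻¹) = ckFro (m g) := by
  rw [S.inv, ckFro_JTJ ckSg_sq]

theorem CKSetup.form_In (S : CKSetup m Γ H) {h : 𝔾} (hh : h ∈ H) (u : R → ℝ) :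
    ∃ u' : R → ℝ, m h *ᵥ ckIn P Q u = ckIn P Q u' ∧ ckN u' = ckN u := by
  obtain ⟨b, R', h1, h2⟩ := S.hform h hh
  refine ⟨R' *ᵥ u, ?_, ?_⟩
  · rw [h1, ckIn, fromBlocks_mulVec]
    simp only [Sum.elim_comp_inl, Sum.elim_comp_inr, zero_mulVec, add_zero, zero_add]
    have : b *ᵥ (fun _ => (0:ℝ)) = fun _ => 0 := mulVec_zero b
    have h3 : (0 : Matrix R (P ⊕ Q) ℝ) *ᵥ (fun _ => (0:ℝ)) = 0 := by simp
    rw [this]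
    rfl
  · rw [ckN_eq_dot, ckN_eq_dot, dotProduct_mulVec, ← mulVec_transpose, mulVec_mulVec, h2, one_mulVec]

theorem CKSetup.bdd (S : CKSetup m Γ H) {a h : 𝔾} (hh : h ∈ H) {n : ℝ}
    (hn : ckFro (m (a * h)) ≤ n) (u : R → ℝ) : ckN (m a *ᵥ ckIn P Q u) ≤ n * ckN u := by
  obtain ⟨u', h1, h2⟩ := S.form_In (H.inv_mem hh) u
  have : m a *ᵥ ckIn P Q u = m (a * h) *ᵥ ckIn P Q u' := by
    rw [← h1, mulVec_mulVec, ← map_mul]; simp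
  rw [this]
  refine (ckN_mulVec_le _ _).trans ?_
  rw [ckN_In, h2]
  exact mul_le_mul_of_nonneg_right hn (ckN_nonneg u)

theorem CKSetup.lemT (S : CKSetup m Γ H) {B : ℝ} {g : 𝔾}
    (hg : ∀ k : R, ckN (m g *ᵥ ckIn P Q (Pi.single k 1)) ≤ B) :
    ∃ h ∈ H, ckFro (m (g * h)) ≤ 2 * (Fintype.card P + Fintype.card R * B) +
      Fintype.card ((P ⊕ Q) ⊕ R) := by
  obtain ⟨h, hh, hmin⟩ := S.hmin g
  refine ⟨h, hh, ?_⟩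
  set M := m (g * h) with hM
  have hMJ := S.hJ (g * h)
  have hMJ' := ck_transpose_J ckSg_sq hMJ
  rw [← hM] at hMJ hMJ'
  -- the entries
  have horth : ∀ i j, ∑ a, M (Sum.inl (Sum.inr a)) (Sum.inl (Sum.inl i)) *
      M (Sum.inl (Sum.inr a)) (Sum.inl (Sum.inr j)) = 0 := by
    intro i j
    have h1 := hmin i j
    have h2 := congrFun (congrFun hMJ (Sum.inl (Sum.inl i))) (Sum.inl (Sum.inr j))
    rw [mul_apply] at h2
    simp only [mul_diagonal, transpose_apply] at h2
    rw [diagonal_apply_ne _ (by simp)] at h2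
    simp [Fintype.sum_sum_type, ckSg] at h1 h2
    linarith
  have hP0 : ∀ i a, M (Sum.inl (Sum.inr a)) (Sum.inl (Sum.inl i)) = 0 := by
    intro i
    set x : Q → ℝ := fun a => M (Sum.inl (Sum.inr a)) (Sum.inl (Sum.inl i)) with hx
    have h1 : ckQ (ckSg P Q R) (Mᵀ *ᵥ ckInQ P R x) = ckQ (ckSg P Q R) (ckInQ P R x) :=
      ckQ_mulVec (by rw [transpose_transpose]; exact hMJ') _
    have h2 : ckQ (ckSg P Q R) (ckInQ P R x) = - ckN x := by
      rw [ckQ_split]; simp [ckInQ, ckN]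
    have h3 : ∀ j, (Mᵀ *ᵥ ckInQ P R x) (Sum.inl (Sum.inr j)) = 0 := by
      intro j
      rw [← horth i j]
      simp [mulVec, dotProduct, Fintype.sum_sum_type, ckInQ, hx, mul_comm]
    have h4 : 0 ≤ ckQ (ckSg P Q R) (Mᵀ *ᵥ ckInQ P R x) := by
      rw [ckQ_split]
      simp only [h3]
      have e1 : 0 ≤ ∑ i, ((Mᵀ *ᵥ ckInQ P R x) (Sum.inl (Sum.inl i))) ^ 2 :=
        Finset.sum_nonneg fun _ _ => sq_nonneg _
      have e2 : 0 ≤ ∑ i, ((Mᵀ *ᵥ ckInQ P R x) (Sum.inr i)) ^ 2 :=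
        Finset.sum_nonneg fun _ _ => sq_nonneg _
      simp only [ne_eq, OfNat.ofNat_ne_zero, not_false_eq_true, zero_pow, Finset.sum_const_zero]
      linarith
    have h5 : ckN x = 0 := le_antisymm (by linarith) (ckN_nonneg x)
    exact fun a => congrFun (ckN_eq_zero.1 h5) a
  have hPc : ∀ i, ckN (fun a => M a (Sum.inl (Sum.inl i))) = 1 := by
    intro i
    have h2 := congrFun (congrFun hMJ (Sum.inl (Sum.inl i))) (Sum.inl (Sum.inl i))
    rw [mul_apply] at h2
    simp only [mul_diagonal, transpose_apply, diagonal_apply_eq] at h2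
    rw [ckN_split]
    simp only [Fintype.sum_sum_type, ckSg, Sum.elim_inl, Sum.elim_inr, hP0] at h2 ⊢
    simp only [mul_one, Finset.sum_const_zero, zero_mul, zero_pow two_ne_zero,
      ← sq] at h2 ⊢
    linarith
  have hRc : ∑ k, ckN (fun a => M a (Sum.inr k)) ≤ Fintype.card R * B := by
    -- columns are transformed by an orthogonal matrix
    obtain ⟨b, R', e1, e2⟩ := S.hform h hh
    set A : Matrix ((P ⊕ Q) ⊕ R) R ℝ := fun a k => m g a (Sum.inr k) with hA
    have h1 : (fun a k => M a (Sum.inr k) : Matrix ((P ⊕ Q) ⊕ R) R ℝ) = A * R' := by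
      ext a k
      rw [hM, map_mul, e1, mul_apply, mul_apply, Fintype.sum_sum_type]
      simp [hA]
    have h2 : ∀ a, ckN (fun k => M a (Sum.inr k)) = ckN (A a) := by
      intro a
      have : (fun k => M a (Sum.inr k)) = R'ᵀ *ᵥ A a := by
        rw [mulVec_transpose]; exact congrFun h1 a
      rw [this, ckN_eq_dot, ckN_eq_dot, dotProduct_mulVec, ← mulVec_transpose, transpose_transpose,
        mulVec_mulVec, mul_eq_one_comm.1 e2, one_mulVec]
    have h3 : ∑ k, ckN (fun a => M a (Sum.inr k)) = ∑ k, ckN (fun a => A a k) := by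
      rw [← ckFro_eq_cols A]
      refine (ckFro_eq_cols (fun a k => M a (Sum.inr k) : Matrix ((P ⊕ Q) ⊕ R) R ℝ)).symm.trans ?_
      exact Finset.sum_congr rfl fun a _ => h2 a
    rw [h3]
    have h4 : ∀ k, ckN (fun a => A a k) ≤ B := by
      intro k
      refine le_of_eq_of_le ?_ (hg k)
      congr 1
      ext a
      simp [mulVec, dotProduct, Fintype.sum_sum_type, ckIn, hA, Pi.single_apply]
    calc _ ≤ ∑ _k : R, B := Finset.sum_le_sum fun k _ => h4 k
      _ = _ := by simp
  have hQc : ∑ j, ckN (fun a => M a (Sum.inl (Sum.inr j))) ≤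
      ∑ i, ckN (fun a => M a (Sum.inl (Sum.inl i))) + ∑ k, ckN (fun a => M a (Sum.inr k)) +
        Fintype.card ((P ⊕ Q) ⊕ R) := by
    have hrow : ∀ a, ∑ j, M a (Sum.inl (Sum.inr j)) ^ 2 ≤
        ∑ i, M a (Sum.inl (Sum.inl i)) ^ 2 + ∑ k, M a (Sum.inr k) ^ 2 + 1 := by
      intro a
      have h2 := congrFun (congrFun hMJ' a) a
      rw [mul_apply] at h2
      simp only [mul_diagonal, transpose_apply, diagonal_apply_eq] at h2
      have h3 : -1 ≤ ckSg P Q R a := by rcases a with (a | a) | a <;> simp [ckSg]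
      rw [← h2] at h3
      simp only [Fintype.sum_sum_type, ckSg, Sum.elim_inl, Sum.elim_inr, mul_one, ← sq, mul_neg,
        neg_mul, Finset.sum_neg_distrib] at h3
      linarith
    have h5 := Finset.sum_le_sum fun a (_ : a ∈ Finset.univ) => hrow a
    simp only [Finset.sum_add_distrib, Finset.sum_const, Finset.card_univ, nsmul_eq_mul,
      mul_one] at h5
    simp only [ckN]
    rw [Finset.sum_comm, Finset.sum_comm (s := (Finset.univ : Finset P)),
      Finset.sum_comm (s := (Finset.univ : Finset R))]
    exact h5
  have hPs : ∑ i, ckN (fun a => M a (Sum.inl (Sum.inl i))) = Fintype.card P := by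
    simp [hPc]
  rw [ckFro_eq_cols, Fintype.sum_sum_type, Fintype.sum_sum_type]
  linarith
end Setup

section Cayley
set_option linter.unusedSectionVars false
variable {P Q R : Type*} [Fintype P] [Fintype Q] [Fintype R]
  [DecidableEq P] [DecidableEq Q] [DecidableEq R]

theorem ck_exists_op (Q R : Type*) [Fintype Q] [Fintype R] [DecidableEq Q] [DecidableEq R]
    [Nonempty R] :
    ∃ op : Matrix Q R ℝ → ℝ, Continuous op ∧ (∀ (c : ℝ) Y, 0 ≤ c → op (c • Y) = c * op Y) ∧
      (∀ Y, 0 ≤ op Y) ∧ (∀ Y, Y ≠ 0 → 0 < op Y) ∧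
      (∀ Y v, ckN (Y *ᵥ v) ≤ op Y ^ 2 * ckN v) ∧
      (∀ Y, ∃ v, ckN v = 1 ∧ ckN (Y *ᵥ v) = op Y ^ 2) := by
  let T : Matrix Q R ℝ →ₗ[ℝ] (EuclideanSpace ℝ R →L[ℝ] EuclideanSpace ℝ Q) :=
    (LinearMap.toContinuousLinearMap :
      (EuclideanSpace ℝ R →ₗ[ℝ] EuclideanSpace ℝ Q) ≃ₗ[ℝ] _).toLinearMap ∘ₗ
      (Matrix.toEuclideanLin (𝕜 := ℝ) (m := Q) (n := R)).toLinearMap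
  have hT : ∀ Y (v : EuclideanSpace ℝ R), T Y v = WithLp.toLp 2 (Y *ᵥ v.ofLp) := fun Y v => rfl
  have hN : ∀ (v : EuclideanSpace ℝ R), ‖v‖ ^ 2 = ckN v.ofLp := by
    intro v
    rw [EuclideanSpace.norm_sq_eq]
    simp [ckN]
  have hN2 : ∀ (v : EuclideanSpace ℝ Q), ‖v‖ ^ 2 = ckN v.ofLp := by
    intro v
    rw [EuclideanSpace.norm_sq_eq]
    simp [ckN]
  have hTc : Continuous T := LinearMap.continuous_of_finiteDimensional T
  refine ⟨fun Y => ‖T Y‖, hTc.norm, ?_, fun Y => norm_nonneg _, ?_, ?_, ?_⟩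
  · intro c Y hc
    simp only [map_smul, norm_smul, Real.norm_of_nonneg hc]
  · intro Y hY
    rw [norm_pos_iff]
    intro h
    apply hY
    apply Matrix.ext_of_mulVec_single
    intro j
    have := hT Y (WithLp.toLp 2 (Pi.single j 1))
    rw [h] at this
    have h2 := congrArg WithLp.ofLp this
    rw [zero_mulVec]
    exact h2.symm
  · intro Y v
    have h1 := (T Y).le_opNorm (WithLp.toLp 2 v)
    have h2 := pow_le_pow_left₀ (norm_nonneg _) h1 2
    rw [mul_pow, hN2, hN, hT] at h2
    exact h2
  · intro Y
    have hne : (Metric.sphere (0 : EuclideanSpace ℝ R) 1).Nonempty :=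
      ⟨EuclideanSpace.single (Classical.arbitrary R) 1, by simp⟩
    obtain ⟨v, hv, hmax⟩ := (isCompact_sphere (0 : EuclideanSpace ℝ R) 1).exists_isMaxOn hne
      ((T Y).continuous.norm.continuousOn)
    have hv1 : ‖v‖ = 1 := by simpa using hv
    refine ⟨v.ofLp, by rw [← hN, hv1, one_pow], ?_⟩
    have e1 : ‖T Y v‖ = ‖T Y‖ := by
      apply le_antisymm
      · have := (T Y).le_opNorm v
        rwa [hv1, mul_one] at this
      · refine ContinuousLinearMap.opNorm_le_of_unit_norm (norm_nonneg _) ?_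
        intro x hx
        exact hmax (show x ∈ Metric.sphere _ _ by simpa using hx)
    show _ = ‖T Y‖ ^ 2
    rw [← e1, hN2, hT]

/-- symmetric off-diagonal matrix built from `Y` -/
def ckZ (P : Type*) {Q R : Type*} (Y : Matrix Q R ℝ) : Matrix ((P ⊕ Q) ⊕ R) ((P ⊕ Q) ⊕ R) ℝ
  | Sum.inl (Sum.inr a), Sum.inr k => Y a k
  | Sum.inr k, Sum.inl (Sum.inr a) => Y a k
  | _, _ => 0

/-- Cayley transform -/
noncomputable def ckCay (P : Type*) {Q R : Type*} [Fintype P] [Fintype Q] [Fintype R]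
    [DecidableEq P] [DecidableEq Q] [DecidableEq R] (Y : Matrix Q R ℝ) :
    Matrix ((P ⊕ Q) ⊕ R) ((P ⊕ Q) ⊕ R) ℝ := (1 + ckZ P Y) * (1 - ckZ P Y)⁻¹

theorem ckZ_mulVec (Y : Matrix Q R ℝ) (v : R → ℝ) (w : Q → ℝ) :
    ckZ P Y *ᵥ (ckIn P Q v + ckInQ P R w) = ckIn P Q (Yᵀ *ᵥ w) + ckInQ P R (Y *ᵥ v) := by
  ext i
  rcases i with (i | i) | i <;>
    simp [mulVec, dotProduct, Fintype.sum_sum_type, ckZ, ckIn, ckInQ]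

theorem ckZ_mulVec' (Y : Matrix Q R ℝ) (z : (P ⊕ Q) ⊕ R → ℝ) :
    ckZ P Y *ᵥ z = ckIn P Q (Yᵀ *ᵥ (fun a => z (Sum.inl (Sum.inr a)))) +
      ckInQ P R (Y *ᵥ (fun k => z (Sum.inr k))) := by
  ext i
  rcases i with (i | i) | i <;>
    simp [mulVec, dotProduct, Fintype.sum_sum_type, ckZ, ckIn, ckInQ]

theorem ckZ_transpose (Y : Matrix Q R ℝ) : (ckZ P Y)ᵀ = ckZ P Y := by
  ext i j
  rcases i with (i | i) | i <;> rcases j with (j | j) | j <;> simp [ckZ]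

theorem ckZ_J (Y : Matrix Q R ℝ) :
    ckZ P Y * diagonal (ckSg P Q R) = - (diagonal (ckSg P Q R) * ckZ P Y) := by
  ext i j
  rw [neg_apply, mul_diagonal, diagonal_mul]
  rcases i with (i | i) | i <;> rcases j with (j | j) | j <;> simp [ckZ, ckSg]

theorem ckZ_unit {Y : Matrix Q R ℝ} {ρ : ℝ} (hρ : ρ < 1)
    (hY : ∀ v, ckN (Y *ᵥ v) ≤ ρ * ckN v) : IsUnit (1 - ckZ P Y) := by
  rw [← mulVec_injective_iff_isUnit]
  have hinj : ∀ z, (1 - ckZ P Y) *ᵥ z = 0 → z = 0 := by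
    intro z hz
    rw [sub_mulVec, one_mulVec, sub_eq_zero, ckZ_mulVec'] at hz
    set zQ : Q → ℝ := fun a => z (Sum.inl (Sum.inr a)) with hzQ
    set zR : R → ℝ := fun k => z (Sum.inr k) with hzR
    have h1 : zQ = Y *ᵥ zR := by
      ext a; simpa [ckIn, ckInQ] using congrFun hz (Sum.inl (Sum.inr a))
    have h2 : zR = Yᵀ *ᵥ zQ := by
      ext a; simpa [ckIn, ckInQ] using congrFun hz (Sum.inr a)
    have h3 : ckN zR = ckN zQ := by
      rw [ckN_eq_dot, ckN_eq_dot]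
      conv_lhs => rw [h2]
      rw [mulVec_transpose, ← dotProduct_mulVec, ← mulVec_transpose, ← h2, ← h1]
    have h4 := hY zR
    rw [← h1, ← h3] at h4
    have h5 : ckN zR = 0 := le_antisymm (by nlinarith [ckN_nonneg zR]) (ckN_nonneg _)
    have h6 := ckN_eq_zero.1 h5
    have h7 := ckN_eq_zero.1 (h3 ▸ h5)
    rw [hz, h6, h7]
    ext i
    rcases i with (i | i) | i <;> simp [ckIn, ckInQ]
  intro x y hxy
  rw [← sub_eq_zero]
  apply hinj
  rw [mulVec_sub]
  exact sub_eq_zero.2 hxy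

theorem ckCay_J {Y : Matrix Q R ℝ} (hu : IsUnit (1 - ckZ P Y)) :
    (ckCay P Y)ᵀ * diagonal (ckSg P Q R) * ckCay P Y = diagonal (ckSg P Q R) := by
  set Z := ckZ P Y with hZ
  set J := diagonal (ckSg P Q R) with hJ
  have hd : IsUnit (1 - Z).det := (isUnit_iff_isUnit_det _).1 hu
  have h1 : (1 - Z)⁻¹ * (1 - Z) = 1 := nonsing_inv_mul _ hd
  have h2 : (1 - Z) * (1 - Z)⁻¹ = 1 := mul_nonsing_inv _ hd
  have hZJ : Z * J = - (J * Z) := ckZ_J Y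
  have e1 : (1 + Z) * J = J * (1 - Z) := by rw [add_mul, mul_sub, hZJ]; simp [sub_eq_add_neg]
  have e2 : J * (1 + Z) = (1 - Z) * J := by rw [sub_mul, mul_add, hZJ]; simp
  have hc : ckCay P Y = (1 + Z) * (1 - Z)⁻¹ := rfl
  have ht : (ckCay P Y)ᵀ = (1 - Z)⁻¹ * (1 + Z) := by
    rw [hc, transpose_mul, transpose_nonsing_inv, transpose_sub, transpose_add, ckZ_transpose,
      transpose_one]
  have e3 : (1 - Z) * (1 + Z) = (1 + Z) * (1 - Z) := by noncomm_ring
  calc (ckCay P Y)ᵀ * J * ckCay P Y = (1 - Z)⁻¹ * ((1 + Z) * J) * ((1 + Z) * (1 - Z)⁻¹) := by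
        rw [ht, hc]; simp only [mul_assoc]
    _ = (1 - Z)⁻¹ * (J * ((1 - Z) * (1 + Z))) * (1 - Z)⁻¹ := by
        rw [e1]; simp only [mul_assoc]
    _ = (1 - Z)⁻¹ * ((J * (1 + Z)) * ((1 - Z) * (1 - Z)⁻¹)) := by
        rw [e3]; simp only [mul_assoc]
    _ = J := by rw [h2, mul_one, e2, ← mul_assoc, h1, one_mul]

theorem ckCay_mulVec {Y : Matrix Q R ℝ} (hu : IsUnit (1 - ckZ P Y)) (v : R → ℝ) :
    ckCay P Y *ᵥ ckIn P Q (v - Yᵀ *ᵥ (Y *ᵥ v)) =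
      ckIn P Q (v + Yᵀ *ᵥ (Y *ᵥ v)) + ckInQ P R ((2:ℝ) • (Y *ᵥ v)) := by
  have hd : IsUnit (1 - ckZ P Y).det := (isUnit_iff_isUnit_det _).1 hu
  have h1 : (1 - ckZ P Y)⁻¹ * (1 - ckZ P Y) = 1 := nonsing_inv_mul _ hd
  have e1 : ckIn P Q (v - Yᵀ *ᵥ (Y *ᵥ v)) =
      (1 - ckZ P Y) *ᵥ (ckIn P Q v + ckInQ P R (Y *ᵥ v)) := by
    rw [sub_mulVec, one_mulVec, ckZ_mulVec]
    ext i
    rcases i with (i | i) | i <;> simp [ckIn, ckInQ]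
  rw [e1, ckCay, mulVec_mulVec, mul_assoc, h1, mul_one, add_mulVec, one_mulVec, ckZ_mulVec]
  ext i
  rcases i with (i | i) | i <;> simp [ckIn, ckInQ] <;> ring

theorem ckZ_cont : Continuous (ckZ P : Matrix Q R ℝ → _) := by
  refine continuous_matrix fun i j => ?_
  rcases i with (i | i) | i <;> rcases j with (j | j) | j <;> simp only [ckZ] <;>
    first | exact continuous_const | exact (continuous_id.matrix_elem _ _)

theorem ckCay_cont {Y : Matrix Q R ℝ} (hu : IsUnit (1 - ckZ P Y)) :
    ContinuousAt (ckCay P) Y := by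
  unfold ckCay
  have hd : IsUnit (1 - ckZ P Y).det := (isUnit_iff_isUnit_det _).1 hu
  have h1 : ContinuousAt (fun Y : Matrix Q R ℝ => 1 - ckZ P Y) Y :=
    (continuous_const.sub ckZ_cont).continuousAt
  have h2 : ContinuousAt (fun A : Matrix ((P ⊕ Q) ⊕ R) ((P ⊕ Q) ⊕ R) ℝ => A⁻¹) (1 - ckZ P Y) :=
    continuousAt_matrix_inv _ (by
      rw [Ring.inverse_eq_inv']
      exact continuousAt_inv₀ hd.ne_zero)
  have h3 : ContinuousAt (fun Y : Matrix Q R ℝ => (1 - ckZ P Y)⁻¹) Y :=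
    ContinuousAt.comp (f := fun Y : Matrix Q R ℝ => 1 - ckZ P Y) h2 h1
  exact ((continuous_const.add ckZ_cont).continuousAt).mul h3

variable {𝔾 : Type*} [Group 𝔾] {m : 𝔾 →* Matrix ((P ⊕ Q) ⊕ R) ((P ⊕ Q) ⊕ R) ℝ} {Γ H : Subgroup 𝔾}

theorem CKSetup.cay (S : CKSetup m Γ H) {Y : Matrix Q R ℝ} {ρ : ℝ} (hρ : ρ < 1)
    (hY : ∀ v, ckN (Y *ᵥ v) ≤ ρ * ckN v) : ∃ g, m g = ckCay P Y := by
  have hu : ∀ t ∈ Set.Icc (0:ℝ) 1, IsUnit (1 - ckZ P (t • Y)) := by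
    intro t ht
    refine ckZ_unit (ρ := ρ) hρ fun v => ?_
    rw [smul_mulVec, ckN_smul]
    have h1 := hY v
    have h2 := ckN_nonneg (Y *ᵥ v)
    have h3 : t ^ 2 ≤ 1 := by nlinarith [ht.1, ht.2]
    nlinarith
  obtain ⟨g, hg⟩ := S.hpath (fun t => ckCay P (t • Y)) (fun t ht =>
    (ContinuousAt.comp (f := fun t : ℝ => t • Y) (ckCay_cont (hu t ht))
      (by fun_prop)).continuousWithinAt) (by
      have : ckZ P (0 : Matrix Q R ℝ) = 0 := by
        ext i j
        rcases i with (i | i) | i <;> rcases j with (j | j) | j <;> simp [ckZ]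
      simp [ckCay, this]) (fun t ht => ckCay_J (hu t ht))
  exact ⟨g, by simpa using hg⟩

theorem CKSetup.rot (S : CKSetup m Γ H) (p0 : P) (r0 : R) (θ : ℝ) :
    ∃ g, m g = ckPlane (Sum.inl (Sum.inl p0)) (Sum.inr r0) (Real.cos θ) (Real.sin θ)
      (-Real.sin θ) := by
  obtain ⟨g, hg⟩ := S.hpath (fun t => ckPlane (Sum.inl (Sum.inl p0)) (Sum.inr r0)
      (Real.cos (t * θ)) (Real.sin (t * θ)) (-Real.sin (t * θ)))
    (ckPlane_cont _ _ (by fun_prop) (by fun_prop) (by fun_prop)).continuousOn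
    (by simp [ckPlane_one]) (fun t _ => by
      have := Real.sin_sq_add_cos_sq (t * θ)
      refine ckPlane_form (by simp) ?_ ?_ ?_ <;> simp [ckSg] <;> linarith)
  exact ⟨g, by simpa using hg⟩
end Cayley

section Kappa
set_option linter.unusedSectionVars false
variable {P Q R : Type*} [Fintype P] [Fintype Q] [Fintype R]
  [DecidableEq P] [DecidableEq Q] [DecidableEq R]
variable {𝔾 : Type*} [Group 𝔾] {m : 𝔾 →* Matrix ((P ⊕ Q) ⊕ R) ((P ⊕ Q) ⊕ R) ℝ} {Γ H : Subgroup 𝔾}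

/-- reflection in the coordinate `r0` -/
def ckEps (r0 : R) : R → ℝ := fun k => if k = r0 then -1 else 1

theorem ckEps_sq (r0 k : R) : ckEps r0 k * ckEps r0 k = 1 := by
  unfold ckEps; split_ifs <;> norm_num

/-- matrix of the inclusion -/
def ckInMat (P Q R : Type*) [DecidableEq R] : Matrix ((P ⊕ Q) ⊕ R) R ℝ :=
  fun i k => ckIn P Q (Pi.single k 1) i

theorem ckInMat_mulVec (u : R → ℝ) : ckInMat P Q R *ᵥ u = ckIn P Q u := by
  ext i
  rcases i with i | i <;> simp [ckInMat, ckIn, mulVec, dotProduct, Pi.single_apply]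

theorem CKSetup.kappa (S : CKSetup m Γ H) (p0 : P) (r0 : R) {E : Type*} [NormedAddCommGroup E]
    (Y : E → Matrix Q R ℝ) (hY : ∀ x, x ≠ 0 → ContinuousAt Y x) :
    ∃ κ : E → Matrix ((P ⊕ Q) ⊕ R) R ℝ,
      (∀ x, x ≠ 0 → ContinuousAt κ x) ∧
      (∀ x, 5 ≤ ‖x‖ → ∀ v, κ x *ᵥ v = ckIn P Q (v + (Y x)ᵀ *ᵥ (Y x *ᵥ v))) ∧
      (∀ x, ‖x‖ ≤ 2 → ∀ v, κ x *ᵥ v = ckIn P Q (diagonal (ckEps r0) *ᵥ v +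
        (Y x)ᵀ *ᵥ (Y x *ᵥ (diagonal (ckEps r0) *ᵥ v)))) ∧
      (∀ x, ∃ k, ckFro (m k) ≤ (Fintype.card ((P ⊕ Q) ⊕ R) : ℝ) ^ 2 ∧
        ∀ w, ∃ v, κ x *ᵥ v = m k *ᵥ ckIn P Q w) ∧
      (∀ x v, κ x *ᵥ v = 0 → v = 0) ∧
      (∀ x v a, (κ x *ᵥ v) (Sum.inl (Sum.inr a)) = 0) := by
  set D : Matrix R R ℝ := diagonal (ckEps r0) with hD
  have hDD : D * D = 1 := by rw [hD, diagonal_mul_diagonal]; simp [ckEps_sq]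
  have hDt : Dᵀ = D := diagonal_transpose _
  set a : E → ℝ := fun x => max 0 (min 1 (‖x‖ - 4)) with ha
  set b : E → ℝ := fun x => max 0 (min 1 (3 - ‖x‖)) with hb
  set θ : E → ℝ := fun x => Real.pi * max 0 (min 1 (4 - ‖x‖)) with hθ
  have hac : Continuous a := by fun_prop
  have hbc : Continuous b := by fun_prop
  have hθc : Continuous θ := by fun_prop
  set M : E → Matrix R R ℝ := fun x => 1 + a x • ((Y x)ᵀ * Y x) + b x • (D * ((Y x)ᵀ * Y x) * D)
    with hM
  set T : E → Matrix ((P ⊕ Q) ⊕ R) ((P ⊕ Q) ⊕ R) ℝ := fun x =>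
    ckPlane (Sum.inl (Sum.inl p0)) (Sum.inr r0) (Real.cos (θ x)) (Real.sin (θ x))
      (-Real.sin (θ x)) with hT
  have hMinj : ∀ x v, M x *ᵥ v = 0 → v = 0 := by
    intro x v hv
    have h1 : v ⬝ᵥ (M x *ᵥ v) = ckN v + a x * ckN (Y x *ᵥ v) + b x * ckN (Y x *ᵥ (D *ᵥ v)) := by
      simp only [hM, add_mulVec, dotProduct_add, one_mulVec, smul_mulVec, dotProduct_smul,
        smul_eq_mul, ← mulVec_mulVec]
      congr 1
      · congr 1
        · rw [ckN_eq_dot]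
        · rw [ckN_eq_dot, dotProduct_mulVec, vecMul_transpose]
      · rw [ckN_eq_dot, dotProduct_mulVec v D, ← mulVec_transpose, hDt,
          dotProduct_mulVec (D *ᵥ v), vecMul_transpose]
    rw [hv, dotProduct_zero] at h1
    have ha0 : 0 ≤ a x := le_max_left _ _
    have hb0 : 0 ≤ b x := le_max_left _ _
    have := mul_nonneg ha0 (ckN_nonneg (Y x *ᵥ v))
    have := mul_nonneg hb0 (ckN_nonneg (Y x *ᵥ (D *ᵥ v)))
    exact ckN_eq_zero.1 (le_antisymm (by linarith) (ckN_nonneg v))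
  have hMu : ∀ x, IsUnit (M x) := by
    intro x
    rw [← mulVec_injective_iff_isUnit]
    intro u v huv
    rw [← sub_eq_zero]
    apply hMinj x
    rw [mulVec_sub]
    exact sub_eq_zero.2 huv
  have hTform : ∀ x, (T x)ᵀ * diagonal (ckSg P Q R) * T x = diagonal (ckSg P Q R) := by
    intro x
    have := Real.sin_sq_add_cos_sq (θ x)
    refine ckPlane_form (by simp) ?_ ?_ ?_ <;> simp [ckSg] <;> linarith
  refine ⟨fun x => T x * ckInMat P Q R * M x, ?_, ?_, ?_, ?_, ?_, ?_⟩
  · intro x hx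
    have hTc : Continuous T := ckPlane_cont _ _ (by fun_prop) (by fun_prop) (by fun_prop)
    have hYx := hY x hx
    have hYt : ContinuousAt (fun x => (Y x)ᵀ * Y x) x := ck_cmul (ck_ctrans hYx) hYx
    have hMc : ContinuousAt M x := by
      refine (continuousAt_const.add (hac.continuousAt.smul hYt)).add (hbc.continuousAt.smul ?_)
      exact ck_cmul (ck_cmul continuousAt_const hYt) continuousAt_const
    exact ck_cmul (ck_cmul hTc.continuousAt continuousAt_const) hMc
  · intro x hx v
    have e1 : a x = 1 := by
      simp only [ha]; rw [min_eq_left (by linarith)]; norm_num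
    have e2 : b x = 0 := by
      simp only [hb]; rw [min_eq_right (by linarith), max_eq_left (by linarith)]
    have e3 : θ x = 0 := by
      simp only [hθ]; rw [min_eq_right (by linarith), max_eq_left (by linarith), mul_zero]
    have e4 : T x = 1 := by simp [hT, e3, ckPlane_one]
    beta_reduce
    rw [e4, Matrix.one_mul, ← mulVec_mulVec, ckInMat_mulVec]
    congr 1
    simp only [hM, e1, e2, add_mulVec, one_mulVec, one_smul, zero_smul, zero_mulVec, add_zero,
      mulVec_mulVec]
  · intro x hx v
    have e1 : a x = 0 := by
      simp only [ha]; rw [min_eq_right (by linarith), max_eq_left (by linarith)]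
    have e2 : b x = 1 := by
      simp only [hb]; rw [min_eq_left (by linarith)]; norm_num
    have e3 : θ x = Real.pi := by
      simp only [hθ]; rw [min_eq_left (by linarith)]; norm_num
    have e4 : ∀ u, T x *ᵥ ckIn P Q u = ckIn P Q (D *ᵥ u) := by
      intro u
      ext i
      rw [hT]
      simp only [e3, Real.cos_pi, Real.sin_pi, neg_zero]
      rw [ckPlane_mulVec (by simp)]
      rcases i with (i | i) | i
      · simp [ckIn]
      · simp [ckIn]
      · have hdd : (D *ᵥ u) i = ckEps r0 i * u i := mulVec_diagonal _ _ _
        simp only [ckIn, Sum.elim_inr, hdd, ckEps]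
        by_cases hi : i = r0
        · simp [hi]
        · simp [hi]
    rw [← mulVec_mulVec, ← mulVec_mulVec, ckInMat_mulVec, e4]
    congr 1
    simp only [hM, e1, e2, add_mulVec, one_mulVec, one_smul, zero_smul, zero_mulVec, add_zero,
      mulVec_add, mulVec_mulVec]
    congr 2
    rw [← mul_assoc, ← mul_assoc D D, hDD, one_mul, Matrix.mul_assoc]
  · intro x
    obtain ⟨k, hk⟩ := S.rot p0 r0 (θ x)
    refine ⟨k, ?_, ?_⟩
    · rw [hk]
      have h1 := Real.cos_sq_le_one (θ x)
      have h2 := Real.sin_sq_le_one (θ x)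
      exact ckPlane_fro_le h1 h2 (by rw [neg_sq]; exact h2)
    · intro w
      obtain ⟨u, hu⟩ := hMu x
      refine ⟨(M x)⁻¹ *ᵥ w, ?_⟩
      have : M x * (M x)⁻¹ = 1 := mul_nonsing_inv _ ((isUnit_iff_isUnit_det _).1 (hMu x))
      beta_reduce
      rw [mulVec_mulVec, Matrix.mul_assoc, this, Matrix.mul_one, ← mulVec_mulVec, ckInMat_mulVec, hk]
  · intro x v hv
    apply hMinj x
    rw [← mulVec_mulVec, ← mulVec_mulVec, ckInMat_mulVec] at hv
    have h1 := ckQ_mulVec (hTform x) (ckIn P Q (M x *ᵥ v))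
    rw [hv, ckQ_In] at h1
    apply ckN_eq_zero.1
    rw [← h1]
    simp [ckQ]
  · intro x v i
    rw [← mulVec_mulVec, ← mulVec_mulVec, ckInMat_mulVec, hT, ckPlane_mulVec (by simp)]
    simp [ckIn]
end Kappa

section Sel
open Topology Filter
set_option linter.unusedSectionVars false
variable {P Q R : Type*} [Fintype P] [Fintype Q] [Fintype R]
  [DecidableEq P] [DecidableEq Q] [DecidableEq R]
variable {𝔾 : Type*} [Group 𝔾] {m : 𝔾 →* Matrix ((P ⊕ Q) ⊕ R) ((P ⊕ Q) ⊕ R) ℝ} {Γ H : Subgroup 𝔾}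

theorem ck_sq_convex {a b : ℝ} (ha : 0 ≤ a) (hb : 0 ≤ b) (hab : a + b = 1) (x y : ℝ) :
    (a * x + b * y) ^ 2 ≤ a * x ^ 2 + b * y ^ 2 := by
  have h1 := mul_nonneg (mul_nonneg ha hb) (sq_nonneg (x - y))
  obtain rfl : b = 1 - a := by linarith
  nlinarith

theorem ckN_convex {I : Type*} [Fintype I] {a b : ℝ} (ha : 0 ≤ a) (hb : 0 ≤ b) (hab : a + b = 1)
    (x y : I → ℝ) : ckN (a • x + b • y) ≤ a * ckN x + b * ckN y := by
  simp only [ckN, Finset.mul_sum, ← Finset.sum_add_distrib]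
  exact Finset.sum_le_sum fun i _ => ck_sq_convex ha hb hab _ _

theorem ckQ_concave {a b : ℝ} (ha : 0 ≤ a) (hb : 0 ≤ b) (hab : a + b = 1)
    (x y : (P ⊕ Q) ⊕ R → ℝ) (hp : ∀ i, x (Sum.inl (Sum.inl i)) = y (Sum.inl (Sum.inl i)))
    (hr : ∀ i, x (Sum.inr i) = y (Sum.inr i)) :
    a * ckQ (ckSg P Q R) x + b * ckQ (ckSg P Q R) y ≤ ckQ (ckSg P Q R) (a • x + b • y) := by
  simp only [ckQ, Finset.mul_sum, ← Finset.sum_add_distrib]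
  refine Finset.sum_le_sum fun i _ => ?_
  have h : ∀ t : ℝ, a * t + b * t = t := fun t => by rw [← add_mul, hab, one_mul]
  rcases i with (i | i) | i
  · simp [ckSg, hp, h]
  · have := ck_sq_convex ha hb hab (x (Sum.inl (Sum.inr i))) (y (Sum.inl (Sum.inr i)))
    simp [ckSg]; linarith
  · simp [ckSg, hr, h]

/-- vectors as matrices -/
def ckMt (x : EuclideanSpace ℝ (Q × R)) : Matrix Q R ℝ := fun a k => x (a, k)

theorem ckMt_cont : Continuous (ckMt : EuclideanSpace ℝ (Q × R) → Matrix Q R ℝ) := by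
  refine continuous_matrix fun i j => ?_
  simp only [ckMt]; fun_prop

theorem ckMt_ne {x : EuclideanSpace ℝ (Q × R)} (hx : x ≠ 0) : ckMt x ≠ 0 := by
  intro h
  apply hx
  ext ⟨a, k⟩
  exact congrFun (congrFun h a) k

/-- the moving vector -/
def ckzz (κ : Matrix ((P ⊕ Q) ⊕ R) R ℝ) (s : ℝ) (y : EuclideanSpace ℝ (Q × R)) (v : R → ℝ) :
    (P ⊕ Q) ⊕ R → ℝ := κ *ᵥ v + ckInQ P R (s • (ckMt y *ᵥ v))

/-- the pointwise condition -/
def ckIneq (A : Matrix ((P ⊕ Q) ⊕ R) ((P ⊕ Q) ⊕ R) ℝ) (δ : ℝ) (z : (P ⊕ Q) ⊕ R → ℝ) : Prop :=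
  δ * ckN (A *ᵥ z) < ckQ (ckSg P Q R) z

theorem ckzz_smul (κ : Matrix ((P ⊕ Q) ⊕ R) R ℝ) (s : ℝ) (y : EuclideanSpace ℝ (Q × R)) (v : R → ℝ)
    (c : ℝ) : ckzz κ s y (c • v) = c • ckzz κ s y v := by
  ext i
  rcases i with (i | i) | i <;> simp [ckzz, ckInQ, mulVec_smul] <;> ring

theorem ckIneq_smul {A : Matrix ((P ⊕ Q) ⊕ R) ((P ⊕ Q) ⊕ R) ℝ} {δ : ℝ} {z : (P ⊕ Q) ⊕ R → ℝ}
    {c : ℝ} (hc : c ≠ 0) (h : ckIneq A δ z) : ckIneq A δ (c • z) := by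
  unfold ckIneq at *
  rw [mulVec_smul, ckN_smul, ckQ_smul]
  have := mul_lt_mul_of_pos_left h (by positivity : 0 < c ^ 2)
  linarith

theorem ckIneq_convex (A : Matrix ((P ⊕ Q) ⊕ R) ((P ⊕ Q) ⊕ R) ℝ) {δ : ℝ} (hδ : 0 ≤ δ)
    (κ : Matrix ((P ⊕ Q) ⊕ R) R ℝ) (s : ℝ) (v : R → ℝ) :
    Convex ℝ {y : EuclideanSpace ℝ (Q × R) | ckIneq A δ (ckzz κ s y v)} := by
  intro x hx y hy a b ha hb hab
  have hz : ckzz κ s (a • x + b • y) v = a • ckzz κ s x v + b • ckzz κ s y v := by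
    have h1 : ckMt (a • x + b • y) = a • ckMt x + b • ckMt y := by ext i j; simp [ckMt]
    have h : ∀ t : ℝ, a * t + b * t = t := fun t => by rw [← add_mul, hab, one_mul]
    ext i
    rcases i with (i | i) | i
    · simp [ckzz, ckInQ, h]
    · simp only [ckzz, ckInQ, h1, add_mulVec, smul_mulVec, Pi.add_apply, Sum.elim_inl, Sum.elim_inr,
        Pi.smul_apply, smul_eq_mul]
      linear_combination - h ((κ *ᵥ v) (Sum.inl (Sum.inr i)))
    · simp [ckzz, ckInQ, h]
  simp only [Set.mem_ofPred_eq, ckIneq] at *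
  rw [hz, mulVec_add, mulVec_smul, mulVec_smul]
  have h1 := ckN_convex ha hb hab (A *ᵥ ckzz κ s x v) (A *ᵥ ckzz κ s y v)
  have h2 := ckQ_concave ha hb hab (ckzz κ s x v) (ckzz κ s y v)
    (fun i => by simp [ckzz, ckInQ]) (fun i => by simp [ckzz, ckInQ])
  have h3 := mul_le_mul_of_nonneg_left h1 hδ
  rcases ha.eq_or_lt with h0 | h0
  · subst h0
    obtain rfl : b = 1 := by linarith
    linarith
  · nlinarith [mul_lt_mul_of_pos_left hx h0, mul_le_mul_of_nonneg_left hy.le hb]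

theorem ck_sphere_compact : IsCompact {v : R → ℝ | ckN v = 1} := by
  refine Metric.isCompact_of_isClosed_isBounded (isClosed_eq continuous_ckN continuous_const) ?_
  refine (Metric.isBounded_closedBall (x := (0 : R → ℝ)) (r := 1)).subset ?_
  intro v hv
  rw [mem_closedBall_zero_iff, pi_norm_le_iff_of_nonneg zero_le_one]
  intro i
  have h1 : v i ^ 2 ≤ ckN v := Finset.single_le_sum (f := fun i => v i ^ 2)
    (fun _ _ => sq_nonneg _) (Finset.mem_univ i)
  rw [hv] at h1
  rw [Real.norm_eq_abs]
  exact abs_le_one_iff_mul_self_le_one.2 (by nlinarith)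

theorem ckIneq_open (A : Matrix ((P ⊕ Q) ⊕ R) ((P ⊕ Q) ⊕ R) ℝ) (δ : ℝ) {E : Type*}
    [TopologicalSpace E] {κ : E → Matrix ((P ⊕ Q) ⊕ R) R ℝ} {s : E → ℝ} {x0 : E}
    (y : EuclideanSpace ℝ (Q × R))
    (hκ : ContinuousAt κ x0) (hs : ContinuousAt s x0)
    (h : ∀ v, v ≠ 0 → ckIneq A δ (ckzz (κ x0) (s x0) y v)) :
    ∀ᶠ x in 𝓝 x0, ∀ v, v ≠ 0 → ckIneq A δ (ckzz (κ x) (s x) y v) := by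
  have h1 : ∀ᶠ x in 𝓝 x0, ∀ v ∈ {v : R → ℝ | ckN v = 1}, ckIneq A δ (ckzz (κ x) (s x) y v) := by
    refine ck_sphere_compact.eventually_forall_of_forall_eventually ?_
    intro v hv
    have hv0 : v ≠ 0 := by rintro rfl; simp [ckN] at hv
    have hc : ContinuousAt (fun z : E × (R → ℝ) => ckzz (κ z.1) (s z.1) y z.2) (x0, v) := by
      have e1 : ContinuousAt (fun z : E × (R → ℝ) => κ z.1) (x0, v) :=
        ContinuousAt.comp (f := Prod.fst) hκ continuousAt_fst
      have e2 : ContinuousAt (fun z : E × (R → ℝ) => s z.1) (x0, v) :=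
        ContinuousAt.comp (f := Prod.fst) hs continuousAt_fst
      have e3 : ContinuousAt (fun z : E × (R → ℝ) => z.2) (x0, v) := continuousAt_snd
      have e4 : Continuous (ckInQ P R : (Q → ℝ) → _) := by
        refine continuous_pi fun i => ?_
        rcases i with (i | i) | i <;> simp only [ckInQ, Sum.elim_inl, Sum.elim_inr] <;> fun_prop
      refine (ck_cmulVec e1 e3).add ?_
      exact ContinuousAt.comp (g := ckInQ P R)
        (f := fun z : E × (R → ℝ) => s z.1 • (ckMt y *ᵥ z.2)) e4.continuousAt
        (e2.smul (ck_cmulVec continuousAt_const e3))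
    unfold ckIneq
    refine ContinuousAt.eventually_lt ?_ ?_ (h v hv0)
    · exact continuousAt_const.mul (ContinuousAt.comp (g := ckN) continuous_ckN.continuousAt
        (ck_cmulVec continuousAt_const hc))
    · exact ContinuousAt.comp (g := ckQ (ckSg P Q R)) (continuous_ckQ _).continuousAt hc
  filter_upwards [h1] with x hx v hv
  have hp := ckN_pos hv
  have h2 : Real.sqrt (ckN v) ≠ 0 := (Real.sqrt_pos.2 hp).ne'
  have h3 := hx ((Real.sqrt (ckN v))⁻¹ • v) (by
    rw [ckN_smul, inv_pow, Real.sq_sqrt hp.le, inv_mul_cancel₀ hp.ne'])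
  have h4 := ckIneq_smul h2 h3
  rwa [← ckzz_smul, smul_smul, mul_inv_cancel₀ h2, one_smul] at h4

/-- group elements moving a coset to a bounded place -/
def ckG (m : 𝔾 →* Matrix ((P ⊕ Q) ⊕ R) ((P ⊕ Q) ⊕ R) ℝ) (Γ H : Subgroup 𝔾) (n : ℝ) (g : 𝔾) :
    Set 𝔾 := {γ | γ ∈ Γ ∧ ∃ h ∈ H, ckFro (m (γ⁻¹ * g * h)) ≤ n}

theorem CKSetup.nbhd (S : CKSetup m Γ H) {E : Type*} [TopologicalSpace E] {g : E → 𝔾} {x0 : E}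
    (hg : ContinuousAt (fun x => m (g x)) x0) (n : ℝ) {C : ℝ}
    (hC : ∀ᶠ x in 𝓝 x0, ckFro (m (g x)) ≤ C) :
    (∀ᶠ x in 𝓝 x0, ckG m Γ H n (g x) ⊆
      ckG m Γ H ((Fintype.card ((P ⊕ Q) ⊕ R) + 1) * n) (g x0)) := by
  have hfin := S.hb (max C n)
  have h1 : ∀ᶠ x in 𝓝 x0, ∀ γ ∈ {γ | γ ∈ Γ ∧ ∃ k, ckFro (m k) ≤ max C n ∧
      ∃ h ∈ H, ckFro (m (γ⁻¹ * k * h)) ≤ max C n},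
      ckFro (m (γ⁻¹ * g x0 * (g x)⁻¹ * γ)) < Fintype.card ((P ⊕ Q) ⊕ R) + 1 := by
    rw [Set.Finite.eventually_all hfin]
    intro γ _
    have hc : ContinuousAt (fun x => ckFro (m (γ⁻¹ * g x0 * (g x)⁻¹ * γ))) x0 := by
      simp only [map_mul, S.inv (g _)]
      refine ContinuousAt.comp (g := ckFro) continuous_ckFro.continuousAt ?_
      refine ck_cmul (ck_cmul continuousAt_const ?_) continuousAt_const
      exact ck_cmul (ck_cmul continuousAt_const (ck_ctrans hg)) continuousAt_const
    refine hc.eventually_lt continuousAt_const ?_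
    have : γ⁻¹ * g x0 * (g x0)⁻¹ * γ = 1 := by group
    rw [this, map_one, ckFro_one]
    linarith
  filter_upwards [h1, hC] with x hx hCx
  rintro γ ⟨hγ, h, hh, hn⟩
  refine ⟨hγ, h, hh, ?_⟩
  have h2 := hx γ ⟨hγ, g x, hCx.trans (le_max_left _ _), h, hh, hn.trans (le_max_right _ _)⟩
  have h3 : γ⁻¹ * g x0 * h = (γ⁻¹ * g x0 * (g x)⁻¹ * γ) * (γ⁻¹ * g x * h) := by group
  rw [h3, map_mul]
  exact (ckFro_mul_le _ _).trans (mul_le_mul h2.le hn (ckFro_nonneg _) (by positivity))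

theorem CKSetup.nearby (S : CKSetup m Γ H) {E : Type*} [TopologicalSpace E] {g : E → 𝔾} {x0 : E}
    (hg : ContinuousAt (fun x => m (g x)) x0) (n : ℝ) {C : ℝ}
    (hC : ∀ᶠ x in 𝓝 x0, ckFro (m (g x)) ≤ C) (δ : ℝ)
    {κ : E → Matrix ((P ⊕ Q) ⊕ R) R ℝ} {s : E → ℝ} (y : EuclideanSpace ℝ (Q × R))
    (hκ : ContinuousAt κ x0) (hs : ContinuousAt s x0)
    (h : ∀ γ ∈ ckG m Γ H ((Fintype.card ((P ⊕ Q) ⊕ R) + 1) * n) (g x0),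
      ∀ v, v ≠ 0 → ckIneq (m γ⁻¹) δ (ckzz (κ x0) (s x0) y v)) :
    ∀ᶠ x in 𝓝 x0, ∀ γ ∈ ckG m Γ H n (g x),
      ∀ v, v ≠ 0 → ckIneq (m γ⁻¹) δ (ckzz (κ x) (s x) y v) := by
  set n' := (Fintype.card ((P ⊕ Q) ⊕ R) + 1) * n with hn'
  have hfin : (ckG m Γ H n' (g x0)).Finite := by
    refine (S.hb (max (ckFro (m (g x0))) n')).subset ?_
    rintro γ ⟨hγ, h, hh, hn⟩
    exact ⟨hγ, g x0, le_max_left _ _, h, hh, hn.trans (le_max_right _ _)⟩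
  have h1 : ∀ᶠ x in 𝓝 x0, ∀ γ ∈ ckG m Γ H n' (g x0),
      ∀ v, v ≠ 0 → ckIneq (m γ⁻¹) δ (ckzz (κ x) (s x) y v) := by
    rw [Set.Finite.eventually_all hfin]
    exact fun γ hγ => ckIneq_open _ δ y hκ hs (h γ hγ)
  filter_upwards [h1, S.nbhd hg n hC] with x hx hx2 γ hγ
  exact hx γ (hx2 hγ)

theorem ck_midU {A : Matrix ((P ⊕ Q) ⊕ R) ((P ⊕ Q) ⊕ R) ℝ}
    (hA : Aᵀ * diagonal (ckSg P Q R) * A = diagonal (ckSg P Q R))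
    (κ : Matrix ((P ⊕ Q) ⊕ R) R ℝ) :
    ∃ U : Matrix Q R ℝ, ∀ v a, (A *ᵥ (κ *ᵥ v + ckInQ P R (U *ᵥ v))) (Sum.inl (Sum.inr a)) = 0 := by
  set B : Matrix Q Q ℝ := fun a b => A (Sum.inl (Sum.inr a)) (Sum.inl (Sum.inr b)) with hB
  have hAB : ∀ u a, (A *ᵥ ckInQ P R u) (Sum.inl (Sum.inr a)) = (B *ᵥ u) a := by
    intro u a
    simp [mulVec, dotProduct, Fintype.sum_sum_type, ckInQ, hB]
  have hu : IsUnit B := by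
    rw [← mulVec_injective_iff_isUnit]
    intro x y hxy
    rw [← sub_eq_zero]
    have h0 : B *ᵥ (x - y) = 0 := by rw [mulVec_sub]; exact sub_eq_zero.2 hxy
    have h1 := ckQ_mulVec hA (ckInQ P R (x - y))
    have h2 : ckQ (ckSg P Q R) (ckInQ P R (x - y)) = - ckN (x - y) := by
      rw [ckQ_split]; simp [ckInQ, ckN]
    rw [h2, ckQ_split] at h1
    simp only [hAB, h0, Pi.zero_apply, ne_eq, OfNat.ofNat_ne_zero, not_false_eq_true, zero_pow,
      Finset.sum_const_zero, sub_zero] at h1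
    have e1 : 0 ≤ ∑ i, ((A *ᵥ ckInQ P R (x - y)) (Sum.inl (Sum.inl i))) ^ 2 :=
      Finset.sum_nonneg fun _ _ => sq_nonneg _
    have e2 : 0 ≤ ∑ i, ((A *ᵥ ckInQ P R (x - y)) (Sum.inr i)) ^ 2 :=
      Finset.sum_nonneg fun _ _ => sq_nonneg _
    exact ckN_eq_zero.1 (le_antisymm (by linarith) (ckN_nonneg _))
  have hBB : B * B⁻¹ = 1 := mul_nonsing_inv _ ((isUnit_iff_isUnit_det _).1 hu)
  set W : Matrix Q R ℝ := fun a k => (A * κ) (Sum.inl (Sum.inr a)) k with hW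
  refine ⟨-(B⁻¹ * W), fun v a => ?_⟩
  rw [mulVec_add, Pi.add_apply, hAB, neg_mulVec, mulVec_neg, mulVec_mulVec, mulVec_mulVec,
    ← Matrix.mul_assoc, hBB, Matrix.one_mul]
  have : (W *ᵥ v) a = ((A * κ) *ᵥ v) (Sum.inl (Sum.inr a)) := rfl
  rw [Pi.neg_apply, this]
  ring

theorem CKSetup.mid (S : CKSetup m Γ H) {n' C1 δ : ℝ}
    (hC1 : ∀ γ ∈ Γ, (∃ k, ckFro (m k) ≤ n' ∧ ∃ h ∈ H, ckFro (m (γ⁻¹ * k * h)) ≤ n') →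
      ckFro (m γ) ≤ C1) (hδ : 0 ≤ δ) (hδ1 : δ * C1 < 1) {g γ0 : 𝔾} (hγ0 : γ0 ∈ ckG m Γ H n' g)
    {κ : Matrix ((P ⊕ Q) ⊕ R) R ℝ} (hκ : ∀ v, κ *ᵥ v = 0 → v = 0)
    (hκ2 : ∀ v a, (κ *ᵥ v) (Sum.inl (Sum.inr a)) = 0) {s : ℝ} (hs : s ≠ 0) :
    ∃ y : EuclideanSpace ℝ (Q × R), ∀ γ ∈ ckG m Γ H n' g,
      ∀ v, v ≠ 0 → ckIneq (m γ⁻¹) δ (ckzz κ s y v) := by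
  obtain ⟨U, hU⟩ := ck_midU (S.hJ γ0⁻¹) κ
  refine ⟨WithLp.toLp 2 fun ak => s⁻¹ * U ak.1 ak.2, ?_⟩
  rintro γ ⟨hγ, h, hh, hn⟩ v hv
  obtain ⟨hγ0, h0, hh0, hn0⟩ := hγ0
  have hz : ckzz κ s (WithLp.toLp 2 fun ak : Q × R => s⁻¹ * U ak.1 ak.2) v =
      κ *ᵥ v + ckInQ P R (U *ᵥ v) := by
    have : ckMt (WithLp.toLp 2 fun ak : Q × R => s⁻¹ * U ak.1 ak.2) = s⁻¹ • U := by
      ext i j; simp [ckMt]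
    rw [ckzz, this, smul_mulVec, smul_smul, mul_inv_cancel₀ hs, one_smul]
  rw [hz]
  set z := κ *ᵥ v + ckInQ P R (U *ᵥ v) with hzdef
  have hz0 : z ≠ 0 := by
    intro h0
    apply hv
    apply hκ
    ext i
    have := congrFun h0 i
    rcases i with (i | i) | i
    · simpa [hzdef, ckInQ] using this
    · exact hκ2 v i
    · simpa [hzdef, ckInQ] using this
  have hAz0 : m γ0⁻¹ *ᵥ z ≠ 0 := by
    intro h0
    apply hz0
    have := congrArg (m γ0 *ᵥ ·) h0
    simpa [mulVec_mulVec, ← map_mul] using this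
  have hQ : ckQ (ckSg P Q R) z = ckN (m γ0⁻¹ *ᵥ z) := by
    rw [← ckQ_mulVec (S.hJ γ0⁻¹) z, ckQ_split, ckN_split]
    simp only [hzdef, hU]
    simp
  have hσ := hC1 (γ0⁻¹ * γ) (Γ.mul_mem (Γ.inv_mem hγ0) hγ) ⟨γ0⁻¹ * g * h0, hn0, h0⁻¹ * h,
    H.mul_mem (H.inv_mem hh0) hh, by
      have : (γ0⁻¹ * γ)⁻¹ * (γ0⁻¹ * g * h0) * (h0⁻¹ * h) = γ⁻¹ * g * h := by group
      rwa [this]⟩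
  rw [← S.fro_inv] at hσ
  have e : m γ⁻¹ *ᵥ z = m (γ0⁻¹ * γ)⁻¹ *ᵥ (m γ0⁻¹ *ᵥ z) := by
    rw [mulVec_mulVec, ← map_mul]; congr 2; group
  unfold ckIneq
  rw [hQ, e]
  have hp := ckN_pos hAz0
  have h1 := (ckN_mulVec_le (m (γ0⁻¹ * γ)⁻¹) (m γ0⁻¹ *ᵥ z)).trans
    (mul_le_mul_of_nonneg_right hσ hp.le)
  have h2 := mul_le_mul_of_nonneg_left h1 hδ
  nlinarith [mul_lt_mul_of_pos_right hδ1 hp]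
end Sel

section Core
open Topology Filter
set_option linter.unusedSectionVars false
variable {P Q R : Type*} [Fintype P] [Fintype Q] [Fintype R]
  [DecidableEq P] [DecidableEq Q] [DecidableEq R]
variable {𝔾 : Type*} [Group 𝔾] {m : 𝔾 →* Matrix ((P ⊕ Q) ⊕ R) ((P ⊕ Q) ⊕ R) ℝ} {Γ H : Subgroup 𝔾}

theorem ck_transpose_bound {Y : Matrix Q R ℝ} {c : ℝ} (hc : 0 ≤ c) (hY : ∀ v, ckN (Y *ᵥ v) ≤ c * ckN v)
    (w : Q → ℝ) : ckN (Yᵀ *ᵥ w) ≤ c * ckN w := by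
  set t := Yᵀ *ᵥ w with ht
  have h1 : ckN t = (Y *ᵥ t) ⬝ᵥ w := by
    rw [ckN_eq_dot]
    nth_rewrite 2 [ht]
    rw [dotProduct_mulVec, vecMul_transpose]
  have h2 : ((Y *ᵥ t) ⬝ᵥ w) ^ 2 ≤ ckN (Y *ᵥ t) * ckN w :=
    Finset.sum_mul_sq_le_sq_mul_sq Finset.univ _ _
  rw [← h1] at h2
  have h3 := mul_le_mul_of_nonneg_right (hY t) (ckN_nonneg w)
  rcases (ckN_nonneg t).eq_or_lt with h0 | h0
  · rw [← h0]; exact mul_nonneg hc (ckN_nonneg w)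
  · nlinarith

theorem ckN_one_sub {Y : Matrix Q R ℝ} {c : ℝ} (hc : 0 ≤ c) (hY : ∀ v, ckN (Y *ᵥ v) ≤ c * ckN v)
    (v : R → ℝ) (hv : ckN v = 1) (hv2 : ckN (Y *ᵥ v) = c) :
    ckN (v - Yᵀ *ᵥ (Y *ᵥ v)) ≤ (1 - c) ^ 2 := by
  have h1 := ck_transpose_bound hc hY (Y *ᵥ v)
  have h2 : ckN (v - Yᵀ *ᵥ (Y *ᵥ v)) = ckN v - 2 * ckN (Y *ᵥ v) + ckN (Yᵀ *ᵥ (Y *ᵥ v)) := by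
    have e : v ⬝ᵥ (Yᵀ *ᵥ (Y *ᵥ v)) = ckN (Y *ᵥ v) := by
      rw [ckN_eq_dot, dotProduct_mulVec, vecMul_transpose]
    have e2 : (Yᵀ *ᵥ (Y *ᵥ v)) ⬝ᵥ v = ckN (Y *ᵥ v) := by rw [dotProduct_comm, e]
    rw [ckN_eq_dot (v - _), sub_dotProduct, dotProduct_sub, dotProduct_sub, e, e2, ckN_eq_dot v,
      ckN_eq_dot (Yᵀ *ᵥ _)]
    ring
  rw [h2, hv]
  rw [hv2] at h1 ⊢
  nlinarith

theorem CKSetup.triv (S : CKSetup m Γ H) {Y : Matrix Q R ℝ} {c : ℝ} (hc1 : c < 1)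
    (hY : ∀ v, ckN (Y *ᵥ v) ≤ c * ckN v) {g : 𝔾} (hg : m g = ckCay P Y) {n δ : ℝ} (hδ : 0 ≤ δ)
    (hδn : δ * n < 1) {w : R → ℝ} (hw : w ≠ 0) {γ : 𝔾} (hγ : γ ∈ ckG m Γ H n g) :
    ckIneq (m γ⁻¹) δ (ckIn P Q (w + Yᵀ *ᵥ (Y *ᵥ w)) + ckInQ P R ((2:ℝ) • (Y *ᵥ w))) := by
  obtain ⟨hγ, h, hh, hn⟩ := hγ
  rw [← ckCay_mulVec (ckZ_unit hc1 hY), ← hg]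
  set u := w - Yᵀ *ᵥ (Y *ᵥ w) with hu
  have hu0 : u ≠ 0 := by
    intro h0
    rw [hu, sub_eq_zero] at h0
    have e : w ⬝ᵥ (Yᵀ *ᵥ (Y *ᵥ w)) = ckN (Y *ᵥ w) := by
      rw [ckN_eq_dot, dotProduct_mulVec, vecMul_transpose]
    rw [← h0, ← ckN_eq_dot] at e
    have := hY w
    have := ckN_pos hw
    nlinarith
  have h1 := S.bdd hh hn u
  have hp := ckN_pos hu0
  unfold ckIneq
  rw [ckQ_mulVec (S.hJ g), ckQ_In, mulVec_mulVec, ← map_mul]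
  have h2 := mul_le_mul_of_nonneg_left h1 hδ
  nlinarith [mul_lt_mul_of_pos_right hδn hp]

theorem CKSetup.nz (S : CKSetup m Γ H) {n δ C4 η : ℝ} (hn1 : 0 ≤ n)
    (hn : ∀ g, ∃ γ ∈ Γ, ∃ h ∈ H, ckFro (m (γ⁻¹ * g * h)) ≤ n) (hδ : 0 < δ)
    (hC4 : ∀ γ ∈ Γ, (∃ k, ckFro (m k) ≤ (Fintype.card ((P ⊕ Q) ⊕ R) : ℝ) ^ 2 ∧
      ∃ h ∈ H, ckFro (m (γ⁻¹ * k * h)) ≤ 2 * (Fintype.card P + Fintype.card R * (1 / δ)) +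
      Fintype.card ((P ⊕ Q) ⊕ R)) → ckFro (m γ) ≤ C4)
    (hη : 0 < η) (hη1 : (C4 * n + 2) * η = 1) (hC40 : 0 ≤ C4)
    {Y : Matrix Q R ℝ} (hY : ∀ v, ckN (Y *ᵥ v) ≤ (1 - η) * ckN v) {v : R → ℝ} (hv : ckN v = 1)
    (hYv : ckN (Y *ᵥ v) = 1 - η) {g : 𝔾} (hg : m g = ckCay P Y)
    {κ : Matrix ((P ⊕ Q) ⊕ R) R ℝ}
    (hκ : ∃ k, ckFro (m k) ≤ (Fintype.card ((P ⊕ Q) ⊕ R) : ℝ) ^ 2 ∧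
        ∀ w, ∃ v, κ *ᵥ v = m k *ᵥ ckIn P Q w)
    (h : ∀ γ ∈ ckG m Γ H n g, ∀ v, v ≠ 0 → ckIneq (m γ⁻¹) δ (κ *ᵥ v)) : False := by
  obtain ⟨γ, hγ, h0, hh0, hn0⟩ := hn g
  obtain ⟨k, hk, hkw⟩ := hκ
  have hB : ∀ i : R, ckN (m (γ⁻¹ * k) *ᵥ ckIn P Q (Pi.single i 1)) ≤ 1 / δ := by
    intro i
    obtain ⟨v, hv⟩ := hkw (Pi.single i 1)
    have hN : ckN (Pi.single i 1 : R → ℝ) = 1 := by simp [ckN, Pi.single_apply, ite_pow]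
    have hQ : ckQ (ckSg P Q R) (κ *ᵥ v) = 1 := by
      rw [hv, ckQ_mulVec (S.hJ k), ckQ_In, hN]
    have hv0 : v ≠ 0 := by
      rintro rfl
      rw [mulVec_zero] at hQ
      simp [ckQ] at hQ
    have h1 := h γ ⟨hγ, h0, hh0, hn0⟩ v hv0
    unfold ckIneq at h1
    rw [hQ, hv, mulVec_mulVec, ← map_mul] at h1
    rw [le_div_iff₀ hδ]
    linarith
  obtain ⟨h1, hh1, hf1⟩ := S.lemT hB
  have hf := hC4 γ hγ ⟨k, hk, h1, hh1, hf1⟩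
  have hηle : η ≤ 1 / 2 := by
    have : 0 ≤ C4 * n := mul_nonneg hC40 hn1
    nlinarith
  have hu := ckN_one_sub (by linarith) hY v hv hYv
  have hgu := ckCay_mulVec (P := P) (ckZ_unit (by linarith) hY) v
  rw [← hg] at hgu
  set u := v - Yᵀ *ᵥ (Y *ᵥ v)
  have e1 : 4 * (1 - η) ≤ ckN (m g *ᵥ ckIn P Q u) := by
    rw [hgu, ckN_split]
    have e : ∑ i, (ckIn P Q (v + Yᵀ *ᵥ (Y *ᵥ v)) + ckInQ P R ((2:ℝ) • (Y *ᵥ v)))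
        (Sum.inl (Sum.inr i)) ^ 2 = 4 * (1 - η) := by
      rw [← hYv, show (4:ℝ) = 2 ^ 2 by norm_num, ← ckN_smul]
      simp [ckN, ckIn, ckInQ]
    rw [e]
    have e2 : 0 ≤ ∑ i, (ckIn P Q (v + Yᵀ *ᵥ (Y *ᵥ v)) + ckInQ P R ((2:ℝ) • (Y *ᵥ v)))
        (Sum.inl (Sum.inl i)) ^ 2 := Finset.sum_nonneg fun _ _ => sq_nonneg _
    have e3 : 0 ≤ ∑ i, (ckIn P Q (v + Yᵀ *ᵥ (Y *ᵥ v)) + ckInQ P R ((2:ℝ) • (Y *ᵥ v)))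
        (Sum.inr i) ^ 2 := Finset.sum_nonneg fun _ _ => sq_nonneg _
    linarith
  have e2 : m g *ᵥ ckIn P Q u = m γ *ᵥ (m (γ⁻¹ * g) *ᵥ ckIn P Q u) := by
    rw [mulVec_mulVec, ← map_mul]; congr 2; group
  have e3 := S.bdd hh0 hn0 u
  have e4 : ckN (m g *ᵥ ckIn P Q u) ≤ C4 * (n * η ^ 2) := by
    rw [e2]
    refine (ckN_mulVec_le _ _).trans (mul_le_mul hf (e3.trans ?_) (ckN_nonneg _) hC40)
    refine mul_le_mul_of_nonneg_left (hu.trans (le_of_eq (by ring))) hn1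
  have e5 : C4 * (n * η ^ 2) = η * (1 - 2 * η) := by rw [← hη1]; ring
  nlinarith

/-- the reflection acting on matrices -/
noncomputable def ckRef (Q : Type*) {R : Type*} [Fintype Q] [Fintype R] [DecidableEq Q]
    [DecidableEq R] (r0 : R) :
    EuclideanSpace ℝ (Q × R) →L[ℝ] EuclideanSpace ℝ (Q × R) :=
  LinearMap.toContinuousLinearMap
    (Matrix.toEuclideanLin (diagonal fun ak : Q × R => ckEps r0 ak.2))

theorem ckRef_mt (r0 : R) (x : EuclideanSpace ℝ (Q × R)) (v : R → ℝ) :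
    ckMt (ckRef Q r0 x) *ᵥ v = ckMt x *ᵥ (diagonal (ckEps r0) *ᵥ v) := by
  have : ckMt (ckRef Q r0 x) = ckMt x * diagonal (ckEps r0) := by
    ext a k
    rw [mul_diagonal]
    simp [ckMt, ckRef, Matrix.toEuclideanLin_apply, mulVec_diagonal, mul_comm]
  rw [this, mulVec_mulVec]

theorem ckRef_det (r0 : R) (hQ : Odd (Fintype.card Q)) : (ckRef Q r0).det < 0 := by
  have h1 : (ckRef Q r0).det = ∏ ak : Q × R, ckEps r0 ak.2 := by
    rw [ckRef, ContinuousLinearMap.det, LinearMap.coe_toContinuousLinearMap,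
      Matrix.toEuclideanLin_eq_toLin_orthonormal, LinearMap.det_toLin, det_diagonal]
  have h2 : ∏ k : R, ckEps r0 k = -1 := by
    simp [ckEps, Finset.prod_ite_eq']
  rw [h1, Fintype.prod_prod_type]
  simp only [h2, Finset.prod_const, Finset.card_univ]
  rw [hQ.neg_one_pow]
  norm_num

theorem ck_fin_bound {s : Set 𝔾} (hs : s.Finite) (f : 𝔾 → ℝ) : ∃ C, 0 ≤ C ∧ ∀ γ ∈ s, f γ ≤ C := by
  obtain ⟨C, hC⟩ := (hs.image f).bddAbove
  exact ⟨max C 0, le_max_right _ _, fun γ hγ => (hC ⟨γ, hγ, rfl⟩).trans (le_max_left _ _)⟩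

theorem CKSetup.false (S : CKSetup m Γ H) (p0 : P) (r0 : R) (hQ : Odd (Fintype.card Q)) :
    False := by
  have : Nonempty R := ⟨r0⟩
  obtain ⟨n0, hn0⟩ := S.ha
  set n : ℝ := max n0 1
  have hn1 : 1 ≤ n := le_max_right _ _
  have hn : ∀ g, ∃ γ ∈ Γ, ∃ h ∈ H, ckFro (m (γ⁻¹ * g * h)) ≤ n := by
    intro g
    obtain ⟨γ, hγ, h, hh, hb⟩ := hn0 g
    exact ⟨γ, hγ, h, hh, hb.trans (le_max_left _ _)⟩
  set n' : ℝ := (Fintype.card ((P ⊕ Q) ⊕ R) + 1) * n with hn'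
  have hnn' : n ≤ n' := by
    have : (0:ℝ) ≤ Fintype.card ((P ⊕ Q) ⊕ R) := by positivity
    rw [hn']; nlinarith
  obtain ⟨C1, hC10, hC1⟩ := ck_fin_bound (S.hb n') (fun γ => ckFro (m γ))
  set δ : ℝ := 1 / (C1 + n + 1) with hδ
  have hδ0 : 0 < δ := by positivity
  have hδC : δ * C1 < 1 := by rw [hδ, one_div_mul_eq_div, div_lt_one (by positivity)]; linarith
  have hδn : δ * n < 1 := by rw [hδ, one_div_mul_eq_div, div_lt_one (by positivity)]; linarith
  set C3 : ℝ := 2 * (Fintype.card P + Fintype.card R * (1 / δ)) + Fintype.card ((P ⊕ Q) ⊕ R)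
  obtain ⟨C4, hC40, hC4⟩ := ck_fin_bound
    (S.hb (max C3 ((Fintype.card ((P ⊕ Q) ⊕ R) : ℝ) ^ 2))) (fun γ => ckFro (m γ))
  set η : ℝ := 1 / (C4 * n + 2) with hη
  have hη0 : 0 < η := by positivity
  have hη1 : (C4 * n + 2) * η = 1 := by rw [hη]; field_simp
  have hηle : η ≤ 1 / 2 := by
    have : 0 ≤ C4 * n := by positivity
    nlinarith
  set ρ : ℝ := Real.sqrt (1 - η) with hρ
  have hρ0 : 0 < ρ := Real.sqrt_pos.2 (by linarith)
  have hρ2 : ρ ^ 2 = 1 - η := Real.sq_sqrt (by linarith)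
  obtain ⟨op, hop1, hop2, hop3, hop4, hop5, hop6⟩ := ck_exists_op Q R
  set Y : EuclideanSpace ℝ (Q × R) → Matrix Q R ℝ := fun x => (ρ / op (ckMt x)) • ckMt x with hYdef
  set s : EuclideanSpace ℝ (Q × R) → ℝ := fun x => 2 * (ρ / op (ckMt x)) with hsdef
  have hpos : ∀ x, x ≠ 0 → 0 < op (ckMt x) := fun x hx => hop4 _ (ckMt_ne hx)
  have hrc : ∀ x, x ≠ 0 → ContinuousAt (fun x => ρ / op (ckMt x)) x := fun x hx =>
    continuousAt_const.div (hop1.comp ckMt_cont).continuousAt (hpos x hx).ne'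
  have hYc : ∀ x, x ≠ 0 → ContinuousAt Y x := fun x hx => (hrc x hx).smul ckMt_cont.continuousAt
  have hsc : ∀ x, x ≠ 0 → ContinuousAt s x := fun x hx => continuousAt_const.mul (hrc x hx)
  have hs0 : ∀ x, x ≠ 0 → s x ≠ 0 := fun x hx =>
    mul_ne_zero two_ne_zero (div_pos hρ0 (hpos x hx)).ne'
  have hopY : ∀ x, x ≠ 0 → op (Y x) = ρ := by
    intro x hx
    have := hpos x hx
    rw [hYdef, hop2 _ _ (by positivity)]
    field_simp
  have hYb : ∀ x, x ≠ 0 → ∀ v, ckN (Y x *ᵥ v) ≤ (1 - η) * ckN v := by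
    intro x hx v
    have := hop5 (Y x) v
    rwa [hopY x hx, hρ2] at this
  have hYs : ∀ x v, s x • (ckMt x *ᵥ v) = (2:ℝ) • (Y x *ᵥ v) := by
    intro x v
    simp only [hsdef, hYdef, smul_mulVec, smul_smul]
  obtain ⟨κ, hκ1, hκ2, hκ3, hκ4, hκ5, hκ6⟩ := S.kappa p0 r0 Y hYc
  have hgex : ∀ x, ∃ g, x ≠ 0 → m g = ckCay P (Y x) := by
    intro x
    by_cases hx : x = 0
    · exact ⟨1, fun h => absurd hx h⟩
    · obtain ⟨g, hg⟩ := S.cay (by linarith : 1 - η < 1) (hYb x hx)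
      exact ⟨g, fun _ => hg⟩
  choose g hg using hgex
  have hgc : ∀ x, x ≠ 0 → ContinuousAt (fun x => m (g x)) x := by
    intro x hx
    have h1 : ContinuousAt (fun x => ckCay P (Y x)) x :=
      ContinuousAt.comp (g := ckCay P) (ckCay_cont (ckZ_unit (by linarith) (hYb x hx))) (hYc x hx)
    refine h1.congr ?_
    filter_upwards [isOpen_ne.mem_nhds hx] with y hy
    exact (hg y hy).symm
  set Cond : EuclideanSpace ℝ (Q × R) → EuclideanSpace ℝ (Q × R) → Prop := fun x y =>
    ∀ γ ∈ ckG m Γ H n (g x), ∀ v, v ≠ 0 → ckIneq (m γ⁻¹) δ (ckzz (κ x) (s x) y v) with hCond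
  set t : EuclideanSpace ℝ (Q × R) → Set (EuclideanSpace ℝ (Q × R)) := fun x =>
    {y | (‖x‖ < 1 → y = ckRef Q r0 x) ∧ (6 < ‖x‖ → y = x) ∧ (x ≠ 0 → Cond x y)} with ht
  have htc : ∀ x, Convex ℝ (t x) := by
    intro x y hy z hz a b ha hb hab
    refine ⟨fun h => ?_, fun h => ?_, fun h γ hγ v hv => ?_⟩
    · rw [hy.1 h, hz.1 h, ← add_smul, hab, one_smul]
    · rw [hy.2.1 h, hz.2.1 h, ← add_smul, hab, one_smul]
    · exact ckIneq_convex (m γ⁻¹) hδ0.le (κ x) (s x) v (hy.2.2 h γ hγ v hv) (hz.2.2 h γ hγ v hv)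
        ha hb hab
  have hdd : ∀ v : R → ℝ, v ≠ 0 → diagonal (ckEps r0) *ᵥ v ≠ 0 := by
    intro v hv h0
    apply hv
    have := congrArg (diagonal (ckEps r0) *ᵥ ·) h0
    simpa [mulVec_mulVec, diagonal_mul_diagonal, ckEps_sq] using this
  have hout : ∀ x, 5 < ‖x‖ → x ∈ t x := by
    intro x hx
    refine ⟨fun h => by linarith, fun _ => rfl, fun h γ hγ v hv => ?_⟩
    rw [ckzz, hκ2 x hx.le, hYs]
    exact S.triv (by linarith) (hYb x h) (hg x h) hδ0.le hδn hv hγ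
  have hin : ∀ x, ‖x‖ < 2 → ckRef Q r0 x ∈ t x := by
    intro x hx
    refine ⟨fun _ => rfl, fun h => by linarith, fun h γ hγ v hv => ?_⟩
    rw [ckzz, hκ3 x hx.le, ckRef_mt, hYs]
    exact S.triv (by linarith) (hYb x h) (hg x h) hδ0.le hδn (hdd v hv) hγ
  obtain ⟨F, hF⟩ := exists_contMDiffMap_forall_mem_convex_of_local
    (modelWithCornersSelf ℝ (EuclideanSpace ℝ (Q × R))) (n := 1) htc (by
      intro x0
      rcases lt_or_ge 5 ‖x0‖ with h5 | h5
      · exact ⟨{x | 5 < ‖x‖}, (isOpen_lt continuous_const continuous_norm).mem_nhds h5, fun x => x,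
          contMDiffOn_id, fun x hx => hout x hx⟩
      rcases lt_or_ge ‖x0‖ 2 with h2 | h2
      · exact ⟨{x | ‖x‖ < 2}, (isOpen_lt continuous_norm continuous_const).mem_nhds h2,
          fun x => ckRef Q r0 x, (ckRef Q r0).contMDiff.contMDiffOn, fun x hx => hin x hx⟩
      have hx0 : x0 ≠ 0 := by rintro rfl; simp at h2; linarith
      obtain ⟨γ0, hγ0, h0, hh0, hb0⟩ := hn (g x0)
      obtain ⟨y, hy⟩ := S.mid (n' := n') (C1 := C1) (δ := δ)
        (fun γ h1 h2 => hC1 γ ⟨h1, h2⟩) hδ0.le hδC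
        (g := g x0) (γ0 := γ0) ⟨hγ0, h0, hh0, hb0.trans hnn'⟩ (hκ5 x0) (hκ6 x0) (hs0 x0 hx0)
      have hev := S.nearby (hgc x0 hx0) n (C := ckFro (m (g x0)) + 1) (by
        have : ContinuousAt (fun x => ckFro (m (g x))) x0 :=
          ContinuousAt.comp (g := ckFro) continuous_ckFro.continuousAt (hgc x0 hx0)
        filter_upwards [this.eventually_lt (continuousAt_const (y := ckFro (m (g x0)) + 1))
          (by linarith)] with x hx using hx.le) δ y (hκ1 x0 hx0) (hsc x0 hx0) hy
      have hlt : ∀ᶠ x in 𝓝 x0, ‖x‖ < 6 :=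
        (isOpen_lt continuous_norm continuous_const).mem_nhds (by
          show ‖x0‖ < 6
          linarith)
      have hgt : ∀ᶠ x in 𝓝 x0, 1 < ‖x‖ :=
        (isOpen_lt continuous_const continuous_norm).mem_nhds (by
          show 1 < ‖x0‖
          linarith)
      refine ⟨_, hev.and (hlt.and hgt), fun _ => y, contMDiffOn_const, ?_⟩
      rintro x ⟨h1, h2, h3⟩
      exact ⟨fun h => by linarith, fun h => by linarith, fun _ => h1⟩)
  refine ck_degree F (contMDiff_iff_contDiff.1 F.contMDiff) (ckRef Q r0) (ckRef_det r0 hQ)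
    (fun x hx => (hF x).1 hx) (fun x hx => (hF x).2.1 hx) ?_
  intro x hx hFx
  have hc := (hF x).2.2 hx
  rw [hFx] at hc
  obtain ⟨v, hv, hYv⟩ := hop6 (Y x)
  rw [hopY x hx, hρ2] at hYv
  refine S.nz (by linarith) hn hδ0 (C4 := C4) ?_ hη0 hη1 hC40 (hYb x hx) hv hYv (hg x hx)
    (hκ4 x) ?_
  · rintro γ hγ ⟨k, hk, h, hh, hb⟩
    exact hC4 γ ⟨hγ, k, hk.trans (le_max_right _ _), h, hh, hb.trans (le_max_left _ _)⟩
  · intro γ hγ v hv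
    have := hc γ hγ v hv
    have e : ckzz (κ x) (s x) 0 v = κ x *ᵥ v := by
      have : ckMt (0 : EuclideanSpace ℝ (Q × R)) = 0 := by ext i j; simp [ckMt]
      rw [ckzz, this, zero_mulVec, smul_zero]
      ext i
      rcases i with (i | i) | i <;> simp [ckInQ]
    rwa [e] at this
end Core

section GroupC
set_option linter.unusedSectionVars false

/-- signs of the standard form -/
def ckFs (a b : ℕ) : Fin (a + b) → ℝ := fun i => if (i : ℕ) < a then (1 : ℝ) else -1

theorem ckFs_sq (a b : ℕ) (i : Fin (a + b)) : ckFs a b i * ckFs a b i = 1 := by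
  unfold ckFs; split_ifs <;> norm_num

theorem ck_formMat (a b : ℕ) : formMat a b = diagonal (ckFs a b) := rfl

theorem ck_mem_indefO {a b : ℕ} {A : GL (Fin (a + b)) ℝ} : A ∈ indefO a b ↔
    (A : Matrix (Fin (a + b)) (Fin (a + b)) ℝ)ᵀ * diagonal (ckFs a b) * A = diagonal (ckFs a b) :=
  Iff.rfl

/-- a form preserving matrix as a group element -/
noncomputable def ckMk {a b : ℕ} (A : Matrix (Fin (a + b)) (Fin (a + b)) ℝ)
    (hA : Aᵀ * diagonal (ckFs a b) * A = diagonal (ckFs a b)) : indefO a b :=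
  ⟨⟨A, diagonal (ckFs a b) * Aᵀ * diagonal (ckFs a b),
    mul_eq_one_comm.1 (ck_left_inv (ckFs_sq a b) hA), ck_left_inv (ckFs_sq a b) hA⟩, hA⟩

theorem ckMk_cont {X : Type*} [TopologicalSpace X] {a b : ℕ}
    {f : X → Matrix (Fin (a + b)) (Fin (a + b)) ℝ} (hf : Continuous f)
    (hA : ∀ x, (f x)ᵀ * diagonal (ckFs a b) * f x = diagonal (ckFs a b)) :
    Continuous fun x => ckMk (f x) (hA x) := by
  refine Continuous.subtype_mk ?_ _
  rw [Units.continuous_iff]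
  refine ⟨hf, ?_⟩
  show Continuous fun x => diagonal (ckFs a b) * (f x)ᵀ * diagonal (ckFs a b)
  exact (continuous_const.matrix_mul hf.matrix_transpose).matrix_mul continuous_const

theorem ck_mem_SOZero {a b : ℕ} {A : GL (Fin (a + b)) ℝ} : A ∈ SOZero a b ↔
    ∃ B : indefO a b, B ∈ connectedComponent (1 : indefO a b) ∧ (B : GL (Fin (a + b)) ℝ) = A :=
  Iff.rfl

theorem ck_SOZero_form {a b : ℕ} {A : GL (Fin (a + b)) ℝ} (hA : A ∈ SOZero a b) :
    (A : Matrix (Fin (a + b)) (Fin (a + b)) ℝ)ᵀ * diagonal (ckFs a b) * A =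
      diagonal (ckFs a b) := by
  obtain ⟨B, _, rfl⟩ := ck_mem_SOZero.1 hA
  exact B.2

theorem ck_path {X : Type*} [TopologicalSpace X] [PreconnectedSpace X] {a b : ℕ}
    {f : X → Matrix (Fin (a + b)) (Fin (a + b)) ℝ} (hf : Continuous f)
    (hA : ∀ x, (f x)ᵀ * diagonal (ckFs a b) * f x = diagonal (ckFs a b)) {x0 : X} (h0 : f x0 = 1)
    (x : X) : ∃ A ∈ SOZero a b, (A : Matrix (Fin (a + b)) (Fin (a + b)) ℝ) = f x := by
  refine ⟨ckMk (f x) (hA x), ck_mem_SOZero.2 ⟨_, ?_, rfl⟩, rfl⟩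
  have h1 := isPreconnected_range (ckMk_cont hf hA)
  have h2 : (1 : indefO a b) ∈ Set.range fun x => ckMk (f x) (hA x) := by
    refine ⟨x0, ?_⟩
    apply Subtype.ext
    apply Units.ext
    exact h0
  exact h1.subset_connectedComponent h2 ⟨x, rfl⟩

theorem ck_fro_compact {I : Type*} [Fintype I] (n : ℝ) :
    IsCompact {A : Matrix I I ℝ | ckFro A ≤ n} := by
  have h : IsCompact {v : I × I → ℝ | ckN v ≤ n} := by
    refine Metric.isCompact_of_isClosed_isBounded (isClosed_le continuous_ckN continuous_const) ?_
    refine (Metric.isBounded_closedBall (x := (0 : I × I → ℝ)) (r := Real.sqrt n)).subset ?_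
    intro v hv
    rw [mem_closedBall_zero_iff, pi_norm_le_iff_of_nonneg (Real.sqrt_nonneg _)]
    intro i
    have h1 : v i ^ 2 ≤ ckN v := Finset.single_le_sum (f := fun i => v i ^ 2)
      (fun _ _ => sq_nonneg _) (Finset.mem_univ i)
    exact Real.abs_le_sqrt (h1.trans hv)
  have h2 : Continuous fun v : I × I → ℝ => (Matrix.of fun i j => v (i, j) : Matrix I I ℝ) := by
    refine continuous_matrix fun i j => ?_
    simp only [of_apply]; fun_prop
  convert h.image h2 using 1
  ext A
  constructor
  · intro hA
    refine ⟨fun ij => A ij.1 ij.2, ?_, rfl⟩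
    show ckN _ ≤ n
    refine le_of_eq_of_le ?_ hA
    simp [ckN, ckFro, Fintype.sum_prod_type]
  · rintro ⟨v, hv, rfl⟩
    have hv' : ckN v ≤ n := hv
    show ckFro _ ≤ n
    refine le_of_eq_of_le ?_ hv'
    simp [ckN, ckFro, Fintype.sum_prod_type]

theorem ck_SOZero_compact (a b : ℕ) (n : ℝ) : IsCompact {A : GL (Fin (a + b)) ℝ | A ∈ SOZero a b ∧
    ckFro (A : Matrix (Fin (a + b)) (Fin (a + b)) ℝ) ≤ n} := by
  set K : Set (Matrix (Fin (a + b)) (Fin (a + b)) ℝ) :=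
    {A | Aᵀ * diagonal (ckFs a b) * A = diagonal (ckFs a b)} ∩ {A | ckFro A ≤ n} with hK
  have hKc : IsCompact K := by
    refine (ck_fro_compact n).inter_left (isClosed_eq ?_ continuous_const)
    exact (continuous_id.matrix_transpose.matrix_mul continuous_const).matrix_mul continuous_id
  have hKs : CompactSpace K := isCompact_iff_compactSpace.1 hKc
  have h1 : IsCompact (Set.range fun A : K => ckMk A.1 A.2.1) :=
    isCompact_range (ckMk_cont continuous_subtype_val fun A => A.2.1)
  have h2 := (h1.inter_left (isClosed_connectedComponent (x := (1 : indefO a b)))).image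
    continuous_subtype_val
  convert h2 using 1
  ext A
  constructor
  · rintro ⟨hA, hn⟩
    obtain ⟨B, hB, rfl⟩ := ck_mem_SOZero.1 hA
    refine ⟨B, ⟨hB, ⟨⟨((B : GL (Fin (a + b)) ℝ) : Matrix _ _ ℝ), B.2, hn⟩, ?_⟩⟩, rfl⟩
    apply Subtype.ext
    apply Units.ext
    rfl
  · rintro ⟨B, ⟨hB, ⟨C, rfl⟩⟩, rfl⟩
    exact ⟨ck_mem_SOZero.2 ⟨_, hB, rfl⟩, C.2.2⟩

theorem ckFro_submatrix {I K : Type*} [Fintype I] [Fintype K] (e : K ≃ I) (A : Matrix I I ℝ) :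
    ckFro (A.submatrix e e) = ckFro A := by
  unfold ckFro
  simp only [submatrix_apply]
  rw [Equiv.sum_comp e (fun i => ∑ j, A i (e j) ^ 2)]
  exact Finset.sum_congr rfl fun i _ => Equiv.sum_comp e (fun j => A i j ^ 2)

theorem ck_form_submatrix {I K : Type*} [Fintype I] [Fintype K] [DecidableEq I] [DecidableEq K]
    (e : K ≃ I) {A : Matrix I I ℝ} {sg : I → ℝ} (hA : Aᵀ * diagonal sg * A = diagonal sg) :
    (A.submatrix e e)ᵀ * diagonal (sg ∘ e) * A.submatrix e e = diagonal (sg ∘ e) := by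
  have h : diagonal (sg ∘ e) = (diagonal sg).submatrix e e := by
    rw [submatrix_diagonal_equiv]
  rw [h, transpose_submatrix, submatrix_mul_equiv, submatrix_mul_equiv, hA]

theorem ckSg_reindex (p r q : ℕ) : ckSg (Fin p) (Fin q) (Fin r) ∘ reindex3 p r q = ckFs (p + r) q := by
  ext i
  obtain ⟨i, rfl⟩ := finSumFinEquiv.surjective i
  rcases i with i | i
  · obtain ⟨i, rfl⟩ := finSumFinEquiv.surjective i
    rcases i with i | i
    · simp [reindex3, ckSg, ckFs, show (i : ℕ) < p + r by omega]
    · simp [reindex3, ckSg, ckFs]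
  · simp [reindex3, ckSg, ckFs]

theorem ckFs_sum (p q : ℕ) : ckFs p q ∘ finSumFinEquiv = Sum.elim (fun _ => 1) (fun _ => -1) := by
  ext i
  rcases i with i | i <;> simp [ckFs]
end GroupC

section WrapC
set_option linter.unusedSectionVars false

/-- the group as a group of matrices in convenient coordinates -/
noncomputable def ckM (p r q : ℕ) : SOZero (p + r) q →*
    Matrix ((Fin p ⊕ Fin q) ⊕ Fin r) ((Fin p ⊕ Fin q) ⊕ Fin r) ℝ where
  toFun g := ((g : GL (Fin (p + r + q)) ℝ) : Matrix (Fin (p + r + q)) (Fin (p + r + q)) ℝ).submatrix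
    (reindex3 p r q).symm (reindex3 p r q).symm
  map_one' := by simp
  map_mul' g h := by
    simp only [Subgroup.coe_mul, Units.val_mul]
    exact (submatrix_mul_equiv _ _ _ _ _).symm

theorem ckM_apply (p r q : ℕ) (g : SOZero (p + r) q) : ckM p r q g =
    ((g : GL (Fin (p + r + q)) ℝ) : Matrix (Fin (p + r + q)) (Fin (p + r + q)) ℝ).submatrix
    (reindex3 p r q).symm (reindex3 p r q).symm := rfl

theorem ckM_fro (p r q : ℕ) (g : SOZero (p + r) q) : ckFro (ckM p r q g) =
    ckFro ((g : GL (Fin (p + r + q)) ℝ) : Matrix (Fin (p + r + q)) (Fin (p + r + q)) ℝ) := by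
  rw [ckM_apply, ckFro_submatrix]

theorem ckM_form (p r q : ℕ) (g : SOZero (p + r) q) :
    (ckM p r q g)ᵀ * diagonal (ckSg (Fin p) (Fin q) (Fin r)) * ckM p r q g =
      diagonal (ckSg (Fin p) (Fin q) (Fin r)) := by
  have h := ck_form_submatrix (reindex3 p r q).symm (ck_SOZero_form g.2)
  rw [← ckSg_reindex, Function.comp_assoc, Equiv.self_comp_symm, Function.comp_id] at h
  exact h

theorem ckM_path_X (p r q : ℕ) {X : Type*} [TopologicalSpace X] [PreconnectedSpace X]
    {c : X → Matrix ((Fin p ⊕ Fin q) ⊕ Fin r) ((Fin p ⊕ Fin q) ⊕ Fin r) ℝ}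
    (hc : Continuous c) (hf : ∀ x, (c x)ᵀ * diagonal (ckSg (Fin p) (Fin q) (Fin r)) * c x =
      diagonal (ckSg (Fin p) (Fin q) (Fin r))) {x0 : X} (h0 : c x0 = 1) (x : X) :
    ∃ g, ckM p r q g = c x := by
  have h1 : Continuous fun x => (c x).submatrix (reindex3 p r q) (reindex3 p r q) :=
    hc.matrix_submatrix _ _
  obtain ⟨A, hA, hA2⟩ := ck_path h1 (fun x => by
    have := ck_form_submatrix (reindex3 p r q) (hf x)
    rwa [ckSg_reindex] at this) (x0 := x0) (by rw [h0, submatrix_one_equiv]) x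
  refine ⟨⟨A, hA⟩, ?_⟩
  rw [ckM_apply]
  show (A : Matrix (Fin (p + r + q)) (Fin (p + r + q)) ℝ).submatrix _ _ = _
  rw [hA2]
  ext i j
  simp

theorem ckM_compact (p r q : ℕ) (n : ℝ) : IsCompact {g : SOZero (p + r) q | ckFro (ckM p r q g) ≤ n} := by
  rw [Subtype.isCompact_iff]
  convert ck_SOZero_compact (p + r) q n using 1
  ext A
  constructor
  · rintro ⟨g, hg, rfl⟩
    refine ⟨g.2, ?_⟩
    rw [← ckM_fro]
    exact hg
  · rintro ⟨hA, hn⟩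
    refine ⟨⟨A, hA⟩, ?_, rfl⟩
    show ckFro (ckM p r q ⟨A, hA⟩) ≤ n
    rw [ckM_fro]
    exact hn

theorem ckM_cont (p r q : ℕ) : Continuous (ckM p r q) := by
  show Continuous fun g : SOZero (p + r) q =>
    ((g : GL (Fin (p + r + q)) ℝ) : Matrix (Fin (p + r + q)) (Fin (p + r + q)) ℝ).submatrix
    (reindex3 p r q).symm (reindex3 p r q).symm
  exact (Units.continuous_val.comp continuous_subtype_val).matrix_submatrix _ _

/-- small block -/
noncomputable def ckBlk {p q : ℕ} (r : ℕ) (B : Matrix (Fin (p + q)) (Fin (p + q)) ℝ)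
    (C : Matrix (Fin r) (Fin r) ℝ) :
    Matrix ((Fin p ⊕ Fin q) ⊕ Fin r) ((Fin p ⊕ Fin q) ⊕ Fin r) ℝ :=
  fromBlocks (B.submatrix finSumFinEquiv finSumFinEquiv) 0 0 C

theorem ckBlk_mul {p q : ℕ} (r : ℕ) (B B' : Matrix (Fin (p + q)) (Fin (p + q)) ℝ) :
    ckBlk r (B * B') 1 = ckBlk r B 1 * ckBlk r B' 1 := by
  simp [ckBlk, fromBlocks_multiply]

theorem ckBlk_cont {p q : ℕ} (r : ℕ) :
    Continuous fun B : Matrix (Fin (p + q)) (Fin (p + q)) ℝ => ckBlk r B 1 :=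
  Continuous.matrix_fromBlocks (continuous_id.matrix_submatrix _ _) continuous_const
    continuous_const continuous_const

theorem ckBlk_fro {p q : ℕ} (r : ℕ) (B : Matrix (Fin (p + q)) (Fin (p + q)) ℝ) :
    ckFro B ≤ ckFro (ckBlk r B 1) := by
  have h : ckFro (ckBlk r B 1) = ckFro (B.submatrix (finSumFinEquiv (m := p) (n := q))
      finSumFinEquiv) + ckFro (1 : Matrix (Fin r) (Fin r) ℝ) := by
    simp only [ckFro, ckBlk]
    rw [Fintype.sum_sum_type]
    congr 1
    · refine Finset.sum_congr rfl fun i _ => ?_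
      rw [Fintype.sum_sum_type]; simp
    · refine Finset.sum_congr rfl fun i _ => ?_
      rw [Fintype.sum_sum_type]; simp
  rw [h, ckFro_submatrix]
  linarith [ckFro_nonneg (1 : Matrix (Fin r) (Fin r) ℝ)]

theorem ckBlk_form {p q : ℕ} (r : ℕ) {B : Matrix (Fin (p + q)) (Fin (p + q)) ℝ}
    (hB : Bᵀ * diagonal (ckFs p q) * B = diagonal (ckFs p q)) :
    (ckBlk r B 1)ᵀ * diagonal (ckSg (Fin p) (Fin q) (Fin r)) * ckBlk r B 1 =
      diagonal (ckSg (Fin p) (Fin q) (Fin r)) := by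
  have h := ck_form_submatrix finSumFinEquiv hB
  rw [ckFs_sum] at h
  have h2 : diagonal (ckSg (Fin p) (Fin q) (Fin r)) =
      fromBlocks (diagonal (Sum.elim (fun _ => 1) (fun _ => -1))) 0 0 1 := by
    rw [← diagonal_one, fromBlocks_diagonal]; rfl
  rw [h2, ckBlk, fromBlocks_transpose, fromBlocks_multiply, fromBlocks_multiply]
  rw [transpose_submatrix] at h
  simp [h]

theorem ck_one_mem_SOZero (a b : ℕ) : (1 : GL (Fin (a + b)) ℝ) ∈ SOZero a b := Subgroup.one_mem _

theorem ckM_H {p r q : ℕ} {g : SOZero (p + r) q} :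
    g ∈ (SOZeroProdSO p r q).subgroupOf (SOZero (p + r) q) ↔
    ∃ B ∈ SOZero p q, ∃ C ∈ SOZero r 0,
      ckM p r q g = ckBlk r (B : Matrix (Fin (p + q)) (Fin (p + q)) ℝ)
        (C : Matrix (Fin (r + 0)) (Fin (r + 0)) ℝ) := by
  rw [Subgroup.mem_subgroupOf]
  constructor
  · rintro ⟨⟨B, C⟩, ⟨hB, hC⟩, h⟩
    refine ⟨B, hB, C, hC, ?_⟩
    rw [ckM_apply, ← h]
    show ((fromBlocks _ 0 0 _).submatrix (reindex3 p r q) (reindex3 p r q)).submatrix _ _ = _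
    rw [submatrix_submatrix, Equiv.self_comp_symm, submatrix_id_id]
    rfl
  · rintro ⟨B, hB, C, hC, h⟩
    refine ⟨⟨B, C⟩, ⟨hB, hC⟩, ?_⟩
    apply Units.ext
    show (ckBlk r (B : Matrix (Fin (p + q)) (Fin (p + q)) ℝ)
        (C : Matrix (Fin (r + 0)) (Fin (r + 0)) ℝ)).submatrix (reindex3 p r q) (reindex3 p r q) = _
    rw [← h, ckM_apply, submatrix_submatrix, Equiv.symm_comp_self, submatrix_id_id]

theorem ckM_emb {p r q : ℕ} {B : GL (Fin (p + q)) ℝ} (hB : B ∈ SOZero p q) :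
    ∃ h ∈ (SOZeroProdSO p r q).subgroupOf (SOZero (p + r) q),
      ckM p r q h = ckBlk r (B : Matrix (Fin (p + q)) (Fin (p + q)) ℝ) 1 := by
  obtain ⟨B0, hB0, rfl⟩ := ck_mem_SOZero.1 hB
  have : PreconnectedSpace (connectedComponent (1 : indefO p q)) :=
    Subtype.preconnectedSpace isPreconnected_connectedComponent
  obtain ⟨g, hg⟩ := ckM_path_X p r q (X := connectedComponent (1 : indefO p q))
    (c := fun x => ckBlk r ((x.1 : GL (Fin (p + q)) ℝ) : Matrix (Fin (p + q)) (Fin (p + q)) ℝ) 1)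
    ((ckBlk_cont r).comp (Units.continuous_val.comp
      (continuous_subtype_val.comp continuous_subtype_val)))
    (fun x => ckBlk_form r x.1.2) (x0 := ⟨1, mem_connectedComponent⟩)
    (by simp [ckBlk]) ⟨B0, hB0⟩
  exact ⟨g, ckM_H.2 ⟨B0, hB, 1, Subgroup.one_mem _, hg⟩, hg⟩

theorem ckN_plane {I : Type*} [Fintype I] [DecidableEq I] {a b : I} (hab : a ≠ b) {c s : ℝ}
    (hc : c ^ 2 = 1 + s ^ 2) (z : I → ℝ) : ckN (ckPlane a b c s s *ᵥ z) =
      ckN z + 2 * s ^ 2 * (z a ^ 2 + z b ^ 2) + 4 * s * c * (z a * z b) := by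
  have h : ∑ i, ((ckPlane a b c s s *ᵥ z) i ^ 2 - z i ^ 2) =
      2 * s ^ 2 * (z a ^ 2 + z b ^ 2) + 4 * s * c * (z a * z b) := by
    simp only [ckPlane_mulVec hab]
    rw [Finset.sum_eq_add a b hab]
    · simp only [if_true, if_neg hab.symm]
      linear_combination (z a ^ 2 + z b ^ 2) * hc
    · intro i _ hi
      rw [if_neg hi.1, if_neg hi.2, sub_self]
    · simp
    · simp
  rw [Finset.sum_sub_distrib] at h
  simp only [ckN] at *
  linarith

theorem ckFro_plane {I : Type*} [Fintype I] [DecidableEq I] {a b : I} (hab : a ≠ b) {c s : ℝ}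
    (hc : c ^ 2 = 1 + s ^ 2) (M : Matrix I I ℝ) : ckFro (M * ckPlane a b c s s) =
      ckFro M + 2 * s ^ 2 * (∑ i, (M i a ^ 2 + M i b ^ 2)) + 4 * s * c * ∑ i, M i a * M i b := by
  have h : ∀ i, (M * ckPlane a b c s s) i = ckPlane a b c s s *ᵥ M i := by
    intro i
    have h0 : ckPlane a b c s s *ᵥ M i = (ckPlane a b c s s)ᵀ *ᵥ M i := by
      rw [ckPlane_transpose hab]
    rw [h0, mulVec_transpose]
    rfl
  show ∑ i, ckN ((M * ckPlane a b c s s) i) = _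
  simp only [h, ckN_plane hab hc]
  rw [Finset.sum_add_distrib, Finset.sum_add_distrib, ← Finset.mul_sum, ← Finset.mul_sum]
  rfl

theorem ck_crit {S X : ℝ} (hS : 0 ≤ S)
    (h : ∀ s : ℝ, 0 ≤ 2 * s ^ 2 * S + 4 * s * Real.sqrt (1 + s ^ 2) * X) : X = 0 := by
  by_contra hX
  set s : ℝ := - X / (S + 1) with hs
  have h1 := h s
  have h2 : 1 ≤ Real.sqrt (1 + s ^ 2) := Real.one_le_sqrt.2 (by nlinarith [sq_nonneg s])
  have h3 : s * X = - (X ^ 2 / (S + 1)) := by rw [hs]; ring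
  have h4 : s ^ 2 * S = X ^ 2 / (S + 1) * (S / (S + 1)) := by rw [hs]; field_simp
  have h5 : S / (S + 1) < 1 := by rw [div_lt_one (by linarith)]; linarith
  have h6 : 0 < X ^ 2 / (S + 1) := by positivity
  have h7 : 4 * s * Real.sqrt (1 + s ^ 2) * X = - (4 * (X ^ 2 / (S + 1))) * Real.sqrt (1 + s ^ 2) := by
    linear_combination 4 * Real.sqrt (1 + s ^ 2) * h3
  rw [h7] at h1
  nlinarith

theorem ckM_boost (p r q : ℕ) (i : Fin p) (j : Fin q) (s : ℝ) : ∃ B ∈ SOZero p q,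
    ckBlk r (B : Matrix (Fin (p + q)) (Fin (p + q)) ℝ) 1 =
      ckPlane (Sum.inl (Sum.inl i)) (Sum.inl (Sum.inr j)) (Real.sqrt (1 + s ^ 2)) s s := by
  have hc : Continuous fun t : ℝ => (ckPlane (Sum.inl i : Fin p ⊕ Fin q) (Sum.inr j)
      (Real.sqrt (1 + t ^ 2)) t t).submatrix finSumFinEquiv.symm finSumFinEquiv.symm :=
    (ckPlane_cont _ _ (by fun_prop) (by fun_prop) (by fun_prop)).matrix_submatrix _ _
  obtain ⟨B, hB, h⟩ := ck_path hc (fun t => by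
    have h1 : (Real.sqrt (1 + t ^ 2)) ^ 2 = 1 + t ^ 2 := Real.sq_sqrt (by positivity)
    have h := ck_form_submatrix finSumFinEquiv.symm (ckPlane_form
      (sg := (Sum.elim (fun _ => 1) (fun _ => -1) : Fin p ⊕ Fin q → ℝ))
      (a := Sum.inl i) (b := Sum.inr j) (c := Real.sqrt (1 + t ^ 2)) (s := t) (s' := t)
      (by simp) (by simp [h1]) (by simp [h1]) (by simp; ring))
    rwa [← ckFs_sum, Function.comp_assoc, Equiv.self_comp_symm, Function.comp_id] at h)
    (x0 := 0) (by simp [ckPlane_one]) s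
  refine ⟨B, hB, ?_⟩
  rw [h, ckBlk, submatrix_submatrix, Equiv.symm_comp_self, submatrix_id_id]
  ext a b
  rcases a with a | a <;> rcases b with b | b
  · simp only [fromBlocks_apply₁₁, ckPlane, Sum.inl.injEq]
  · simp [ckPlane]
  · simp [ckPlane]
  · simp [ckPlane, one_apply]

theorem ckM_min (p r q : ℕ) (g : SOZero (p + r) q) :
    ∃ h ∈ (SOZeroProdSO p r q).subgroupOf (SOZero (p + r) q), ∀ i j,
    ∑ a, ckM p r q (g * h) a (Sum.inl (Sum.inl i)) * ckM p r q (g * h) a (Sum.inl (Sum.inr j)) = 0 := by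
  set M := ckM p r q g with hM
  set f : GL (Fin (p + q)) ℝ → ℝ := fun B =>
    ckFro (M * ckBlk r (B : Matrix (Fin (p + q)) (Fin (p + q)) ℝ) 1) with hf
  have hfc : Continuous f := continuous_ckFro.comp
    (continuous_const.matrix_mul ((ckBlk_cont r).comp Units.continuous_val))
  have hco : ∀ B : GL (Fin (p + q)) ℝ,
      ckFro (B : Matrix (Fin (p + q)) (Fin (p + q)) ℝ) ≤ ckFro (ckM p r q g⁻¹) * f B := by
    intro B
    refine (ckBlk_fro r _).trans ?_
    refine le_of_eq_of_le ?_ (ckFro_mul_le _ _)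
    rw [hM, ← Matrix.mul_assoc, ← map_mul, inv_mul_cancel, map_one, Matrix.one_mul]
  have hK := ck_SOZero_compact p q (ckFro (ckM p r q g⁻¹) * f 1)
  obtain ⟨B, hB, hBmin⟩ := hK.exists_isMinOn ⟨1, Subgroup.one_mem _, hco 1⟩ hfc.continuousOn
  have hmin : ∀ B' ∈ SOZero p q, f B ≤ f B' := by
    intro B' hB'
    by_cases h : ckFro (B' : Matrix (Fin (p + q)) (Fin (p + q)) ℝ) ≤ ckFro (ckM p r q g⁻¹) * f 1
    · exact hBmin ⟨hB', h⟩
    · push Not at h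
      have h1 := h.trans_le (hco B')
      have h2 : f B ≤ f 1 := hBmin ⟨Subgroup.one_mem _, hco 1⟩
      have h3 := lt_of_mul_lt_mul_left h1 (ckFro_nonneg _)
      linarith
  obtain ⟨h, hh, hhB⟩ := ckM_emb (r := r) hB.1
  refine ⟨h, hh, fun i j => ?_⟩
  have hgh : ckM p r q (g * h) = M * ckBlk r (B : Matrix (Fin (p + q)) (Fin (p + q)) ℝ) 1 := by
    rw [map_mul, hhB]
  rw [hgh]
  set N := M * ckBlk r (B : Matrix (Fin (p + q)) (Fin (p + q)) ℝ) 1 with hN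
  refine ck_crit (S := ∑ a, (N a (Sum.inl (Sum.inl i)) ^ 2 + N a (Sum.inl (Sum.inr j)) ^ 2))
    (by positivity) fun s => ?_
  obtain ⟨B', hB', hb⟩ := ckM_boost p r q i j s
  have h1 := hmin (B * B') (Subgroup.mul_mem _ hB.1 hB')
  simp only [hf, Units.val_mul, ckBlk_mul, hb] at h1
  rw [← Matrix.mul_assoc, ← hN, ckFro_plane (by simp) (Real.sq_sqrt (by positivity))] at h1
  linarith

theorem ckM_setup {p r q : ℕ} {Γ : Subgroup (SOZero (p + r) q)}
    (hpd : ProperlyDiscontinuousSMul Γ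
      (SOZero (p + r) q ⧸ (SOZeroProdSO p r q).subgroupOf (SOZero (p + r) q)))
    (hcs : CompactSpace (Quotient (MulAction.orbitRel Γ
      (SOZero (p + r) q ⧸ (SOZeroProdSO p r q).subgroupOf (SOZero (p + r) q))))) :
    CKSetup (ckM p r q) Γ ((SOZeroProdSO p r q).subgroupOf (SOZero (p + r) q)) where
  hJ := ckM_form p r q
  hpath := by
    intro c hc h0 hf
    have : PreconnectedSpace (Set.Icc (0:ℝ) 1) := Subtype.preconnectedSpace isPreconnected_Icc
    exact ckM_path_X p r q (X := Set.Icc (0:ℝ) 1) (c := fun x => c x.1)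
      (continuousOn_iff_continuous_domRestrict.1 hc) (fun x => hf x.1 x.2) (x0 := ⟨0, by simp⟩) h0
      ⟨1, by simp⟩
  hform := by
    intro h hh
    obtain ⟨B, hB, C, hC, e⟩ := ckM_H.1 hh
    refine ⟨_, _, e, ?_⟩
    have h1 := ck_SOZero_form hC
    have h2 : diagonal (ckFs r 0) = (1 : Matrix (Fin (r + 0)) (Fin (r + 0)) ℝ) := by
      rw [← diagonal_one]
      congr 1
      ext i
      simp only [ckFs]
      exact if_pos i.2
    rw [h2, Matrix.mul_one] at h1
    exact h1
  hmin := ckM_min p r q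
  ha := by
    set H := (SOZeroProdSO p r q).subgroupOf (SOZero (p + r) q)
    let U : ℕ → Set (Quotient (MulAction.orbitRel Γ (SOZero (p + r) q ⧸ H))) := fun n =>
      (Quotient.mk (MulAction.orbitRel Γ (SOZero (p + r) q ⧸ H))) ''
        ((QuotientGroup.mk : SOZero (p + r) q → SOZero (p + r) q ⧸ H) ''
          {g | ckFro (ckM p r q g) < n})
    have hcc : ContinuousConstSMul Γ (SOZero (p + r) q ⧸ H) :=
      ⟨fun γ => (continuous_const_smul (γ : SOZero (p + r) q) :
        Continuous fun x : SOZero (p + r) q ⧸ H => (γ : SOZero (p + r) q) • x)⟩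
    have hUo : ∀ n, IsOpen (U n) := by
      intro n
      refine isOpenMap_quotient_mk'_mul _ (QuotientGroup.isOpenMap_coe _ ?_)
      exact isOpen_lt (continuous_ckFro.comp (ckM_cont p r q)) continuous_const
    have hUm : Directed (· ⊆ ·) U := by
      refine (monotone_nat_of_le_succ fun n => ?_).directed_le
      refine Set.image_mono (Set.image_mono ?_)
      intro g hg
      have hg' : ckFro (ckM p r q g) < n := hg
      show ckFro (ckM p r q g) < ((n + 1 : ℕ) : ℝ)
      push_cast
      linarith
    have hUc : Set.univ ⊆ ⋃ n, U n := by
      intro x _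
      induction x using Quotient.inductionOn with
      | h y =>
        induction y using QuotientGroup.induction_on with
        | H g =>
          obtain ⟨n, hn⟩ := exists_nat_gt (ckFro (ckM p r q g))
          exact Set.mem_iUnion.2 ⟨n, _, ⟨g, hn, rfl⟩, rfl⟩
    obtain ⟨n, hn⟩ := isCompact_univ.elim_directed_cover U hUo hUc hUm
    refine ⟨n, fun g => ?_⟩
    obtain ⟨y, ⟨g', hg', rfl⟩, hy⟩ := hn (Set.mem_univ
      (Quotient.mk (MulAction.orbitRel Γ (SOZero (p + r) q ⧸ H)) (QuotientGroup.mk g)))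
    obtain ⟨γ, hγ⟩ := Quotient.exact hy
    have h1 : (QuotientGroup.mk ((γ : SOZero (p + r) q) * g) : SOZero (p + r) q ⧸ H) =
      QuotientGroup.mk g' := hγ
    rw [QuotientGroup.eq] at h1
    refine ⟨(γ : SOZero (p + r) q)⁻¹, Γ.inv_mem γ.2, _, h1, ?_⟩
    have : ((γ : SOZero (p + r) q)⁻¹)⁻¹ * g * (((γ : SOZero (p + r) q) * g)⁻¹ * g') = g' := by group
    rw [this]
    exact le_of_lt hg'
  hb := by
    intro n
    set H := (SOZeroProdSO p r q).subgroupOf (SOZero (p + r) q)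
    have hK : IsCompact ((QuotientGroup.mk : SOZero (p + r) q → SOZero (p + r) q ⧸ H) ''
        {g | ckFro (ckM p r q g) ≤ n}) := (ckM_compact p r q n).image QuotientGroup.continuous_mk
    have hfin := hpd.finite_disjoint_inter_image hK hK
    refine (hfin.image Subtype.val).subset ?_
    rintro γ ⟨hγ, k, hk, h, hh, hn⟩
    refine ⟨⟨γ, hγ⟩, ?_, rfl⟩
    refine ⟨QuotientGroup.mk k, ⟨QuotientGroup.mk (γ⁻¹ * k * h), ⟨_, hn, rfl⟩, ?_⟩, ⟨k, hk, rfl⟩⟩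
    show (QuotientGroup.mk (γ * (γ⁻¹ * k * h)) : SOZero (p + r) q ⧸ H) = QuotientGroup.mk k
    rw [QuotientGroup.eq]
    have : (γ * (γ⁻¹ * k * h))⁻¹ * k = h⁻¹ := by group
    rw [this]
    exact H.inv_mem hh

end WrapC


/-- For all integers `p, q, r ≥ 1` with `q` odd, the irreducible symmetric
space `SO₀(p+r,q)/(SO₀(p,q) × SO(r))` does not admit a compact Clifford–Klein form. -/
theorem statement1 (p q r : ℕ) (hp : 1 ≤ p) (hq : 1 ≤ q) (hr : 1 ≤ r) (hqodd : Odd q) :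
    ¬ AdmitsCompactCliffordKleinForm
      ((SOZeroProdSO p r q).subgroupOf (SOZero (p + r) q)) := by
  rintro ⟨Γ, _, hpd, _, hcs⟩
  exact (ckM_setup hpd hcs).false ⟨0, hp⟩ ⟨0, hr⟩ (by simpa using hqodd)

end
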